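/- Let (φ_t)_{t≥0} be a non-elliptic semigroup of holomorphic functions on the unit disc 𝔻, i.e. a semigroup admitting no common fixed point τ ∈ 𝔻 with φ_t(τ) = τ for all t ≥ 0. Then [φ_t, BMOA] ≠ VMOA and [φ_t, 𝓑] ≠ 𝓑₀. -/

import Mathlib

open Complex MeasureTheory Set Filter

noncomputable section

/-- The open unit disc in the complex plane. -/
def unitDisc : Set ℂ := Metric.ball 0 1

/-- The Möbius involution `φ_a(z) = (a - z)/(1 - conj(a) z)`. -/
def mobius (a z : ℂ) : ℂ := (a - z) / (1 - (starRingEnd ℂ) a * z)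

/-- The hyperbolic distance on the unit disc. -/
def hypDist (a z : ℂ) : ℝ :=
  (1 / 2) * Real.log ((1 + ‖mobius a z‖) / (1 - ‖mobius a z‖))

/-- The `BMOA` Garsia-type seminorm squared at the point `a`, with normalized
area measure `dm = dx dy / π`. -/
def bmoaSemi (f : ℂ → ℂ) (a : ℂ) : ℝ :=
  (Real.pi)⁻¹ * ∫ z in unitDisc, ‖deriv f z‖ ^ 2 * (1 - ‖mobius a z‖ ^ 2)

/-- `f` is an analytic function of bounded mean oscillation. -/
def IsBMOA (f : ℂ → ℂ) : Prop :=
  DifferentiableOn ℂ f unitDisc ∧ ∃ C : ℝ, ∀ a ∈ unitDisc, bmoaSemi f a ≤ C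

/-- `f` is an analytic function of vanishing mean oscillation. -/
def IsVMOA (f : ℂ → ℂ) : Prop :=
  IsBMOA f ∧ ∀ ε > 0, ∃ r < 1, ∀ a ∈ unitDisc, r < ‖a‖ → bmoaSemi f a < ε

/-- The Bloch quantity `|f'(z)| (1 - |z|²)`. -/
def blochSemi (f : ℂ → ℂ) (z : ℂ) : ℝ := ‖deriv f z‖ * (1 - ‖z‖ ^ 2)

/-- `f` belongs to the Bloch space. -/
def IsBloch (f : ℂ → ℂ) : Prop :=
  DifferentiableOn ℂ f unitDisc ∧ ∃ C : ℝ, ∀ z ∈ unitDisc, blochSemi f z ≤ C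

/-- `f` belongs to the little Bloch space. -/
def IsLittleBloch (f : ℂ → ℂ) : Prop :=
  IsBloch f ∧ ∀ ε > 0, ∃ r < 1, ∀ z ∈ unitDisc, r < ‖z‖ → blochSemi f z < ε

/-- The `BMOA` norm `|f(0)| + ‖f‖_*`. -/
def bmoaNorm (f : ℂ → ℂ) : ℝ :=
  ‖f 0‖ + Real.sqrt (⨆ a : unitDisc, bmoaSemi f (a : ℂ))

/-- The Bloch norm `|f(0)| + sup_z |f'(z)|(1-|z|²)`. -/
def blochNorm (f : ℂ → ℂ) : ℝ :=
  ‖f 0‖ + ⨆ z : unitDisc, blochSemi f (z : ℂ)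

/-- `φ` is a semigroup of holomorphic self-maps of the unit disc. -/
def IsHoloSemigroup (φ : ℝ → ℂ → ℂ) : Prop :=
  (∀ t : ℝ, 0 ≤ t → DifferentiableOn ℂ (φ t) unitDisc ∧ MapsTo (φ t) unitDisc unitDisc) ∧
  (∀ z ∈ unitDisc, φ 0 z = z) ∧
  (∀ t : ℝ, 0 ≤ t → ∀ s : ℝ, 0 ≤ s → ∀ z ∈ unitDisc, φ (t + s) z = φ t (φ s z)) ∧
  (∀ K ⊆ unitDisc, IsCompact K →
    TendstoUniformlyOn (fun t z => φ t z) id (nhdsWithin 0 (Ioi 0)) K)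

/-- The maximal subspace of strong continuity `[φ_t, BMOA]`. -/
def maxSubspaceBMOA (φ : ℝ → ℂ → ℂ) : Set (ℂ → ℂ) :=
  {f | IsBMOA f ∧
    Tendsto (fun t => bmoaNorm (fun z => f (φ t z) - f z)) (nhdsWithin 0 (Ioi 0)) (nhds 0)}

/-- The maximal subspace of strong continuity `[φ_t, 𝓑]`. -/
def maxSubspaceBloch (φ : ℝ → ℂ → ℂ) : Set (ℂ → ℂ) :=
  {f | IsBloch f ∧
    Tendsto (fun t => blochNorm (fun z => f (φ t z) - f z)) (nhdsWithin 0 (Ioi 0)) (nhds 0)}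

/-- `G` is the infinitesimal generator of the semigroup `φ`. -/
def IsGenerator (φ : ℝ → ℂ → ℂ) (G : ℂ → ℂ) : Prop :=
  DifferentiableOn ℂ G unitDisc ∧
  ∀ z ∈ unitDisc,
    Tendsto (fun t : ℝ => (φ t z - z) / (t : ℂ)) (nhdsWithin 0 (Ioi 0)) (nhds (G z))

/-- The semigroup is elliptic: its Denjoy–Wolff point lies in the disc. -/
def IsElliptic (φ : ℝ → ℂ → ℂ) : Prop :=
  ∃ τ ∈ unitDisc, ∀ t : ℝ, 0 ≤ t → φ t τ = τ

/-- The logarithmic vanishing Bloch condition (LVB) on a generator `G`. -/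
def LVB (G : ℂ → ℂ) : Prop :=
  ∀ ε > 0, ∃ r < 1, ∀ z ∈ unitDisc, r < ‖z‖ →
    (1 - ‖z‖ ^ 2) / ‖G z‖ * Real.log (1 / (1 - ‖z‖ ^ 2)) < ε

/-- The logarithmic vanishing mean oscillation condition (LVMO) on a generator `G`. -/
def LVMO (G : ℂ → ℂ) : Prop :=
  ∀ ε > 0, ∃ r < 1, ∀ a ∈ unitDisc, r < ‖a‖ →
    (Real.log (Real.exp 1 / (1 - ‖a‖ ^ 2))) ^ 2 *
      ((Real.pi)⁻¹ * ∫ z in unitDisc, (1 - ‖mobius a z‖ ^ 2) / ‖G z‖ ^ 2) < ε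

/-- `f` belongs to the logarithmic little Bloch space `𝓑_{log,0}`. -/
def InBlochLog0 (f : ℂ → ℂ) : Prop :=
  ∀ ε > 0, ∃ r < 1, ∀ z ∈ unitDisc, r < ‖z‖ →
    ‖deriv f z‖ * (1 - ‖z‖ ^ 2) * Real.log (Real.exp 1 / (1 - ‖z‖ ^ 2)) < ε

/-- `f` belongs to `VMOA_log`. -/
def InVMOAlog (f : ℂ → ℂ) : Prop :=
  ∀ ε > 0, ∃ r < 1, ∀ a ∈ unitDisc, r < ‖a‖ →
    (Real.log (Real.exp 1 / (1 - ‖a‖ ^ 2))) ^ 2 * bmoaSemi f a < ε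

/-- Hyperbolic midpoint of the segment `[0, w]`. -/
def wstar (w : ℂ) : ℂ :=
  (((1 - Real.sqrt (1 - ‖w‖ ^ 2)) / ‖w‖ ^ 2 : ℝ) : ℂ) * w

/-- The building-block function `β_w(z) = Log(e / (1 + conj(w) φ_{w*}(z)))`. -/
def betaB (w z : ℂ) : ℂ :=
  Complex.log ((Real.exp 1 : ℂ) / (1 + (starRingEnd ℂ) w * mobius (wstar w) z))

/-- The (invariant) Carleson box `S(I_u)` associated with a point `u ∈ 𝔻 \ {0}`. -/
def carlesonBox (u : ℂ) : Set ℂ :=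
  {z ∈ unitDisc | ((starRingEnd ℂ) u * mobius u z).re ≤ 0}

/-- The generalized Volterra operator `T_g f(z) = ∫₀^z f(ζ) g'(ζ) dζ`. -/
def volterra (g f : ℂ → ℂ) (z : ℂ) : ℂ :=
  z * ∫ t in (0:ℝ)..1, f ((t : ℂ) * z) * deriv g ((t : ℂ) * z)

lemma hasSum_prod_mul {f g : ℕ → ℂ} {a b : ℂ} (hf : HasSum f a) (hg : HasSum g b)
    (hf' : Summable fun n => ‖f n‖) (hg' : Summable fun n => ‖g n‖) :
    HasSum (fun p : ℕ × ℕ => f p.1 * g p.2) (a * b) :=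
  hf.mul hg (summable_mul_of_summable_norm hf' hg')

/-- The circle integral of a single Fourier mode. -/
lemma integral_exp_int_mul_I (k : ℤ) :
    ∫ θ in (-Real.pi)..Real.pi, Complex.exp (k * θ * I) = if k = 0 then 2 * (Real.pi : ℂ) else 0 := by
  split_ifs with hk
  · subst hk
    simp
    ring
  · have hc : (k : ℂ) * I ≠ 0 := by simp [hk]
    have h := integral_exp_mul_complex (a := -Real.pi) (b := Real.pi) hc
    have e : (fun θ : ℝ => Complex.exp (k * θ * I)) = fun θ : ℝ => Complex.exp (k * I * θ) := by
      funext θ; ring_nf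
    rw [e, h]
    have : Complex.exp (k * I * (Real.pi : ℝ)) = Complex.exp (k * I * ((-Real.pi : ℝ) : ℂ)) := by
      rw [Complex.exp_eq_exp_iff_exists_int]
      exact ⟨k, by push_cast; ring⟩
    rw [this, sub_self, zero_div]

/-- Parseval's identity for absolutely convergent one-sided Fourier series. -/
lemma hasSum_sq_norm_of_fourier (c : ℕ → ℂ) (hc : Summable fun n => ‖c n‖) (F : ℝ → ℂ)
    (hF : ∀ θ : ℝ, HasSum (fun n : ℕ => c n * Complex.exp (n * θ * I)) (F θ)) :
    HasSum (fun n => 2 * Real.pi * ‖c n‖ ^ 2) (∫ θ in (-Real.pi)..Real.pi, ‖F θ‖ ^ 2) := by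
  have hexp : ∀ (n : ℕ) (θ : ℝ), ‖Complex.exp (n * θ * I)‖ = 1 := by
    intro n θ
    have := Complex.norm_exp_ofReal_mul_I (n * θ)
    push_cast at this
    exact this
  have hnorm : ∀ (n : ℕ) (θ : ℝ), ‖c n * Complex.exp (n * θ * I)‖ = ‖c n‖ := by
    intro n θ; rw [norm_mul, hexp, mul_one]
  have hprod : ∀ θ : ℝ, HasSum (fun p : ℕ × ℕ => (c p.1 * Complex.exp (p.1 * θ * I)) *
      (starRingEnd ℂ) (c p.2 * Complex.exp (p.2 * θ * I))) (F θ * (starRingEnd ℂ) (F θ)) := by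
    intro θ
    have h2 : HasSum (fun n : ℕ => (starRingEnd ℂ) (c n * Complex.exp (n * θ * I)))
        ((starRingEnd ℂ) (F θ)) := Complex.hasSum_conj'.2 (hF θ)
    have h3 := hasSum_prod_mul (hF θ) h2 (by simpa only [hnorm] using hc)
      (by simpa only [RCLike.norm_conj, hnorm] using hc)
    exact h3
  have hint := intervalIntegral.hasSum_integral_of_dominated_convergence (μ := volume)
    (a := -Real.pi) (b := Real.pi)
    (F := fun (p : ℕ × ℕ) (θ : ℝ) => (c p.1 * Complex.exp (p.1 * θ * I)) *
      (starRingEnd ℂ) (c p.2 * Complex.exp (p.2 * θ * I)))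
    (f := fun θ => F θ * (starRingEnd ℂ) (F θ))
    (fun p _ => ‖c p.1‖ * ‖c p.2‖)
    (fun p => Continuous.aestronglyMeasurable (by fun_prop))
    (fun p => ae_of_all _ fun θ _ => by
      rw [norm_mul, RCLike.norm_conj, hnorm, hnorm])
    (ae_of_all _ fun θ _ => hc.mul_of_nonneg hc (fun _ => norm_nonneg _) fun _ => norm_nonneg _)
    intervalIntegrable_const
    (ae_of_all _ fun θ _ => hprod θ)
  have hterm : ∀ p : ℕ × ℕ, (∫ θ in (-Real.pi)..Real.pi, (c p.1 * Complex.exp (p.1 * θ * I)) *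
      (starRingEnd ℂ) (c p.2 * Complex.exp (p.2 * θ * I))) =
      if p.1 = p.2 then ((2 * Real.pi * ‖c p.1‖ ^ 2 : ℝ) : ℂ) else 0 := by
    intro p
    have e : (fun θ : ℝ => (c p.1 * Complex.exp (p.1 * θ * I)) *
        (starRingEnd ℂ) (c p.2 * Complex.exp (p.2 * θ * I))) = fun θ : ℝ =>
        (c p.1 * (starRingEnd ℂ) (c p.2)) * Complex.exp (((p.1 - p.2 : ℤ) : ℂ) * θ * I) := by
      funext θ
      rw [map_mul, ← Complex.exp_conj]
      have : Complex.exp (((p.1 - p.2 : ℤ) : ℂ) * θ * I) = Complex.exp (p.1 * θ * I) *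
          Complex.exp ((starRingEnd ℂ) (p.2 * θ * I)) := by
        rw [← Complex.exp_add]
        congr 1
        simp
        ring
      rw [this]
      ring
    rw [e, intervalIntegral.integral_const_mul, integral_exp_int_mul_I]
    by_cases h : p.1 = p.2
    · simp only [h, sub_self, if_true]
      rw [Complex.mul_conj, Complex.normSq_eq_norm_sq]
      push_cast
      ring
    · rw [if_neg h, if_neg, mul_zero]
      omega
  simp only [hterm] at hint
  have hinj : Function.Injective (fun n : ℕ => (n, n)) := fun a b h => (Prod.mk.inj h).1
  rw [← hinj.hasSum_iff] at hint
  · have hval : (∫ θ in (-Real.pi)..Real.pi, F θ * (starRingEnd ℂ) (F θ)) =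
        ((∫ θ in (-Real.pi)..Real.pi, ‖F θ‖ ^ 2 : ℝ) : ℂ) := by
      rw [← intervalIntegral.integral_ofReal]
      congr 1
      funext θ
      rw [Complex.mul_conj, Complex.normSq_eq_norm_sq]
    rw [hval] at hint
    exact Complex.hasSum_ofReal.1 (by simpa [Function.comp_def] using hint)
  · rintro ⟨n, m⟩ h
    rw [if_neg]
    intro hnm
    exact h ⟨n, Prod.ext rfl hnm⟩

/-- Taylor coefficients at the origin. -/
def taylorCoeff (h : ℂ → ℂ) (n : ℕ) : ℂ := (n.factorial : ℂ)⁻¹ * iteratedDeriv n h 0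

lemma hasSum_taylorCoeff {h : ℂ → ℂ} (hh : DifferentiableOn ℂ h unitDisc) {z : ℂ}
    (hz : z ∈ unitDisc) : HasSum (fun n => taylorCoeff h n * z ^ n) (h z) := by
  have := Complex.hasSum_taylorSeries_on_ball hh hz
  refine this.congr_fun ?_ 
  intro n
  simp [taylorCoeff]
  ring

lemma taylorCoeff_deriv (h : ℂ → ℂ) (n : ℕ) :
    taylorCoeff (deriv h) n = (n + 1) * taylorCoeff h (n + 1) := by
  have h1 : ((n : ℂ) + 1) ≠ 0 := by exact_mod_cast n.succ_ne_zero
  have h2 : (n.factorial : ℂ) ≠ 0 := by exact_mod_cast n.factorial_ne_zero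
  rw [taylorCoeff, taylorCoeff, iteratedDeriv_succ', Nat.factorial_succ]
  push_cast
  field_simp

lemma summable_norm_taylorCoeff {h : ℂ → ℂ} (hh : DifferentiableOn ℂ h unitDisc) {r : ℝ}
    (hr0 : 0 ≤ r) (hr : r < 1) : Summable fun n => ‖taylorCoeff h n * (r : ℂ) ^ n‖ :=
  (hasSum_taylorCoeff hh (z := r) (by simpa [unitDisc, abs_of_nonneg hr0] using hr)).summable.norm

/-- Parseval's identity on a circle of radius `r < 1`. -/
lemma hasSum_circle {h : ℂ → ℂ} (hh : DifferentiableOn ℂ h unitDisc) {r : ℝ}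
    (hr0 : 0 ≤ r) (hr : r < 1) :
    HasSum (fun n => 2 * Real.pi * (‖taylorCoeff h n‖ ^ 2 * (r ^ 2) ^ n))
      (∫ θ in (-Real.pi)..Real.pi, ‖h (r * Complex.exp (θ * I))‖ ^ 2) := by
  have := hasSum_sq_norm_of_fourier (fun n => taylorCoeff h n * (r : ℂ) ^ n)
    (summable_norm_taylorCoeff hh hr0 hr) (fun θ => h (r * Complex.exp (θ * I))) (fun θ => by
      have hz : (r * Complex.exp (θ * I) : ℂ) ∈ unitDisc := by
        simpa [unitDisc, Complex.norm_exp_ofReal_mul_I, abs_of_nonneg hr0] using hr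
      refine (hasSum_taylorCoeff hh hz).congr_fun fun n => ?_
      rw [mul_pow, ← Complex.exp_nat_mul]
      ring_nf)
  refine this.congr_fun fun n => ?_
  rw [norm_mul, norm_pow, Complex.norm_real, Real.norm_of_nonneg hr0]
  ring

lemma isOpen_unitDisc : IsOpen unitDisc := Metric.isOpen_ball

lemma mem_unitDisc {z : ℂ} : z ∈ unitDisc ↔ ‖z‖ < 1 := by simp [unitDisc]

lemma polarCoord_symm_eq (p : ℝ × ℝ) :
    Complex.polarCoord.symm p = p.1 * Complex.exp (p.2 * I) := by
  rw [Complex.polarCoord_symm_apply, Complex.exp_mul_I]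
  push_cast
  ring

/-- The radial moment of the weight `1 - |z|²`. -/
lemma lintegral_radial (n : ℕ) {A : ℝ} (hA : 0 ≤ A) :
    ∫⁻ r in Ioo (0 : ℝ) 1,
      ENNReal.ofReal (r * (1 - r ^ 2) * (2 * Real.pi * (A * (r ^ 2) ^ n))) =
      ENNReal.ofReal (Real.pi * (A / ((n + 1) * (n + 2)))) := by
  have h1 : ((n : ℝ) + 1) ≠ 0 := by positivity
  have h2 : ((n : ℝ) + 2) ≠ 0 := by positivity
  rw [← ofReal_integral_eq_lintegral_ofReal]
  · congr 1
    rw [← integral_Ioc_eq_integral_Ioo, ← intervalIntegral.integral_of_le zero_le_one]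
    have hd : ∀ r ∈ uIcc (0 : ℝ) 1, HasDerivAt
        (fun r : ℝ => Real.pi * A * (r ^ (2 * n + 2) / (n + 1) - r ^ (2 * n + 4) / (n + 2)))
        (r * (1 - r ^ 2) * (2 * Real.pi * (A * (r ^ 2) ^ n))) r := by
      intro r _
      have e1 := (hasDerivAt_pow (2 * n + 2) r).div_const ((n : ℝ) + 1)
      have e2 := (hasDerivAt_pow (2 * n + 4) r).div_const ((n : ℝ) + 2)
      refine ((e1.sub e2).const_mul (Real.pi * A)).congr_deriv ?_
      have i1 : 2 * n + 2 - 1 = 2 * n + 1 := by omega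
      have i2 : 2 * n + 4 - 1 = 2 * n + 3 := by omega
      rw [i1, i2]
      push_cast
      field_simp
      ring
    rw [intervalIntegral.integral_eq_sub_of_hasDerivAt hd
      (Continuous.intervalIntegrable (by fun_prop) _ _)]
    simp
    field_simp
    ring
  · exact (Continuous.integrableOn_Icc (by fun_prop)).mono_set Ioo_subset_Icc_self
  · refine (ae_restrict_iff' measurableSet_Ioo).2 (ae_of_all _ fun r hr => ?_)
    have : 0 ≤ 1 - r ^ 2 := by nlinarith [hr.1, hr.2]
    have := hr.1.le
    simp only [Pi.zero_apply]
    positivity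

/-- The weighted Bergman norm in terms of Taylor coefficients. -/
lemma lintegral_sq_mul_weight {H : ℂ → ℂ} (hH : DifferentiableOn ℂ H unitDisc) :
    ∫⁻ z in unitDisc, ENNReal.ofReal (‖H z‖ ^ 2 * (1 - ‖z‖ ^ 2)) =
      ∑' n, ENNReal.ofReal (Real.pi * (‖taylorCoeff H n‖ ^ 2 / ((n + 1) * (n + 2)))) := by
  classical
  set G : ℂ → ENNReal :=
    unitDisc.indicator fun z => ENNReal.ofReal (‖H z‖ ^ 2 * (1 - ‖z‖ ^ 2)) with hG
  have hcont : ContinuousOn (fun z => ENNReal.ofReal (‖H z‖ ^ 2 * (1 - ‖z‖ ^ 2))) unitDisc :=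
    ENNReal.continuous_ofReal.comp_continuousOn
      ((hH.continuousOn.norm.pow 2).mul (by fun_prop))
  have hGm : Measurable G := by
    rw [hG, ← piecewise_eq_indicator]
    exact hcont.measurable_piecewise continuousOn_const isOpen_unitDisc.measurableSet
  rw [← lintegral_indicator isOpen_unitDisc.measurableSet, ← hG,
    ← Complex.lintegral_comp_polarCoord_symm, polarCoord_target, Measure.volume_eq_prod,
    ← Measure.prod_restrict, lintegral_prod]
  · have hinner : ∀ r ∈ Ioi (0 : ℝ),
        ∫⁻ θ in Ioo (-Real.pi) Real.pi,
          ENNReal.ofReal r • G (Complex.polarCoord.symm (r, θ)) =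
        (Ioo (0 : ℝ) 1).indicator (fun r => ∑' n, ENNReal.ofReal (r * (1 - r ^ 2) *
          (2 * Real.pi * (‖taylorCoeff H n‖ ^ 2 * (r ^ 2) ^ n)))) r := by
      intro r hr
      have hr0 : 0 < r := hr
      have hn : ∀ θ : ℝ, ‖(r * Complex.exp (θ * I) : ℂ)‖ = r := fun θ => by
        simp [Complex.norm_exp_ofReal_mul_I, abs_of_pos hr0]
      simp only [polarCoord_symm_eq]
      by_cases hr1 : r < 1
      · rw [indicator_of_mem (show r ∈ Ioo (0 : ℝ) 1 from ⟨hr0, hr1⟩)]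
        have hw : 0 ≤ r * (1 - r ^ 2) := mul_nonneg hr0.le (by nlinarith)
        have hP := hasSum_circle hH hr0.le hr1
        have hPm := hP.mul_left (r * (1 - r ^ 2))
        rw [← ENNReal.ofReal_tsum_of_nonneg (fun n => by positivity) hPm.summable, hPm.tsum_eq,
          intervalIntegral.integral_of_le (by linarith [Real.pi_pos]),
          integral_Ioc_eq_integral_Ioo, ← integral_const_mul, ofReal_integral_eq_lintegral_ofReal]
        · refine lintegral_congr fun θ => ?_
          rw [hG, indicator_of_mem (mem_unitDisc.2 (by rw [hn]; exact hr1)), hn, smul_eq_mul,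
            ← ENNReal.ofReal_mul hr0.le]
          congr 1
          ring
        · have hc : Continuous fun θ : ℝ => H (r * Complex.exp (θ * I)) :=
            hH.continuousOn.comp_continuous (by fun_prop)
              fun θ => mem_unitDisc.2 (by rw [hn]; exact hr1)
          exact (continuous_const.mul (hc.norm.pow 2)).integrableOn_Icc.mono_set Ioo_subset_Icc_self
        · exact ae_of_all _ fun θ => by simp only [Pi.zero_apply]; positivity
      · rw [indicator_of_notMem (fun h => hr1 h.2)]
        simp only [hG]
        have : ∀ θ : ℝ, (r * Complex.exp (θ * I) : ℂ) ∉ unitDisc := fun θ h =>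
          hr1 (by rw [mem_unitDisc, hn] at h; exact h)
        simp [indicator_of_notMem (this _)]
    rw [setLIntegral_congr_fun measurableSet_Ioi hinner, setLIntegral_indicator measurableSet_Ioo,
      inter_eq_left.2 (fun r hr => hr.1), lintegral_tsum (fun n => by fun_prop)]
    exact tsum_congr fun n => lintegral_radial n (by positivity)
  · refine Measurable.aemeasurable ?_
    have : Measurable fun p : ℝ × ℝ => Complex.polarCoord.symm p := by
      simp only [polarCoord_symm_eq]
      fun_prop
    exact (by fun_prop : Measurable fun p : ℝ × ℝ => ENNReal.ofReal p.1).smul (hGm.comp this)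

/-- The kernel `1 / (1 - conj a z)`. -/
def szegoKernel (a z : ℂ) : ℂ := (1 - (starRingEnd ℂ) a * z)⁻¹

lemma norm_conj_mul_lt_one {a z : ℂ} (ha : a ∈ unitDisc) (hz : z ∈ unitDisc) :
    ‖(starRingEnd ℂ) a * z‖ < 1 := by
  rw [mem_unitDisc] at ha hz
  rw [norm_mul, RCLike.norm_conj]
  nlinarith [norm_nonneg a, norm_nonneg z]

lemma one_sub_conj_mul_ne_zero {a z : ℂ} (ha : a ∈ unitDisc) (hz : z ∈ unitDisc) :
    1 - (starRingEnd ℂ) a * z ≠ 0 := by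
  intro h
  have h1 := norm_conj_mul_lt_one ha hz
  rw [← sub_eq_zero.1 h, norm_one] at h1
  exact lt_irrefl _ h1

lemma differentiableOn_szegoKernel {a : ℂ} (ha : a ∈ unitDisc) :
    DifferentiableOn ℂ (szegoKernel a) unitDisc :=
  DifferentiableOn.inv (by fun_prop) fun _ hz => one_sub_conj_mul_ne_zero ha hz

lemma normSq_one_sub_conj_mul (a z : ℂ) :
    ‖1 - (starRingEnd ℂ) a * z‖ ^ 2 - ‖a - z‖ ^ 2 = (1 - ‖a‖ ^ 2) * (1 - ‖z‖ ^ 2) := by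
  simp only [← Complex.normSq_eq_norm_sq, Complex.normSq_apply]
  simp
  ring

lemma one_sub_sq_norm_mobius {a z : ℂ} (ha : a ∈ unitDisc) (hz : z ∈ unitDisc) :
    1 - ‖mobius a z‖ ^ 2 = (1 - ‖a‖ ^ 2) * (‖szegoKernel a z‖ ^ 2 * (1 - ‖z‖ ^ 2)) := by
  have h := norm_ne_zero_iff.2 (one_sub_conj_mul_ne_zero ha hz)
  have h2 := normSq_one_sub_conj_mul a z
  rw [mobius, szegoKernel, norm_div, norm_inv]
  generalize ‖1 - (starRingEnd ℂ) a * z‖ = d at h h2 ⊢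
  field_simp
  linarith

lemma one_sub_sq_norm_pos {z : ℂ} (hz : z ∈ unitDisc) : 0 < 1 - ‖z‖ ^ 2 := by
  rw [mem_unitDisc] at hz
  nlinarith [norm_nonneg z]

lemma circle_szegoKernel_le {a : ℂ} (ha : a ∈ unitDisc) {r : ℝ} (hr0 : 0 ≤ r) (hr : r < 1) :
    ∫ θ in (-Real.pi)..Real.pi, ‖szegoKernel a (r * Complex.exp (θ * I))‖ ^ 2 ≤
      2 * Real.pi * (1 - ‖a‖ ^ 2)⁻¹ := by
  have hr' : (r : ℂ) ∈ unitDisc := by simpa [mem_unitDisc, abs_of_nonneg hr0] using hr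
  have hlt := norm_conj_mul_lt_one ha hr'
  have hp := hasSum_sq_norm_of_fourier (fun n => ((starRingEnd ℂ) a * r) ^ n)
    (by simpa only [norm_pow] using summable_geometric_of_lt_one (norm_nonneg _) hlt)
    (fun θ => szegoKernel a (r * Complex.exp (θ * I))) (fun θ => by
      have := hasSum_geometric_of_norm_lt_one (ξ := (starRingEnd ℂ) a * (r * Complex.exp (θ * I)))
        (by rwa [← mul_assoc, norm_mul, Complex.norm_exp_ofReal_mul_I, mul_one])
      refine this.congr_fun fun n => ?_
      rw [mul_assoc (n : ℂ), Complex.exp_nat_mul, ← mul_pow, mul_assoc])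
  have hx : (‖a‖ * r) ^ 2 < 1 := by
    rw [norm_mul, RCLike.norm_conj, Complex.norm_real, Real.norm_of_nonneg hr0] at hlt
    nlinarith [mul_nonneg (norm_nonneg a) hr0]
  have hg := (hasSum_geometric_of_lt_one (sq_nonneg _) hx).mul_left (2 * Real.pi)
  have heq := hp.unique (hg.congr_fun fun n => by
    rw [norm_pow, norm_mul, RCLike.norm_conj, Complex.norm_real, Real.norm_of_nonneg hr0]
    ring)
  rw [heq]
  have h1 := one_sub_sq_norm_pos ha
  gcongr
  exact mul_le_of_le_one_right (norm_nonneg a) hr.le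

/-- A bound on the `L²` means over circles bounds the weighted Dirichlet integral. -/
lemma lintegral_deriv_le_of_circle {h : ℂ → ℂ} (hh : DifferentiableOn ℂ h unitDisc) {B : ℝ}
    (hB : ∀ r : ℝ, 0 ≤ r → r < 1 →
      ∫ θ in (-Real.pi)..Real.pi, ‖h (r * Complex.exp (θ * I))‖ ^ 2 ≤ 2 * Real.pi * B) :
    ∫⁻ z in unitDisc, ENNReal.ofReal (‖deriv h z‖ ^ 2 * (1 - ‖z‖ ^ 2)) ≤
      ENNReal.ofReal (Real.pi * B) := by
  have hfin : ∀ s : Finset ℕ, ∑ n ∈ s, ‖taylorCoeff h n‖ ^ 2 ≤ B := by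
    intro s
    have hr : ∀ r : ℝ, 0 ≤ r → r < 1 → ∑ n ∈ s, ‖taylorCoeff h n‖ ^ 2 * (r ^ 2) ^ n ≤ B := by
      intro r hr0 hr1
      have h1 := sum_le_hasSum s (fun n _ => by positivity) (hasSum_circle hh hr0 hr1)
      rw [← Finset.mul_sum] at h1
      exact le_of_mul_le_mul_left (h1.trans (hB r hr0 hr1)) (by positivity)
    have hlim : Tendsto (fun r : ℝ => ∑ n ∈ s, ‖taylorCoeff h n‖ ^ 2 * (r ^ 2) ^ n)
        (nhdsWithin 1 (Iio 1)) (nhds (∑ n ∈ s, ‖taylorCoeff h n‖ ^ 2)) := by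
      have : Continuous fun r : ℝ => ∑ n ∈ s, ‖taylorCoeff h n‖ ^ 2 * (r ^ 2) ^ n := by fun_prop
      simpa using (this.tendsto 1).mono_left nhdsWithin_le_nhds
    refine le_of_tendsto hlim ?_
    filter_upwards [Ioo_mem_nhdsLT (zero_lt_one' ℝ)] with r hr'
    exact hr r hr'.1.le hr'.2
  have hsum : Summable fun n => ‖taylorCoeff h n‖ ^ 2 :=
    summable_of_sum_le (fun _ => sq_nonneg _) hfin
  rw [lintegral_sq_mul_weight (hh.deriv isOpen_unitDisc)]
  have hterm : ∀ n : ℕ, Real.pi * (‖taylorCoeff (deriv h) n‖ ^ 2 / ((n + 1) * (n + 2))) ≤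
      Real.pi * ‖taylorCoeff h (n + 1)‖ ^ 2 := by
    intro n
    have hn : ‖(n + 1 : ℂ)‖ = n + 1 := by exact_mod_cast Complex.norm_natCast (n + 1)
    rw [taylorCoeff_deriv, norm_mul, hn]
    gcongr
    rw [div_le_iff₀ (by positivity)]
    nlinarith [mul_nonneg (by positivity : (0 : ℝ) ≤ n + 1) (sq_nonneg ‖taylorCoeff h (n + 1)‖)]
  have hs1 : Summable fun n => ‖taylorCoeff h (n + 1)‖ ^ 2 := (summable_nat_add_iff 1).2 hsum
  calc _ ≤ ∑' n : ℕ, ENNReal.ofReal (Real.pi * ‖taylorCoeff h (n + 1)‖ ^ 2) :=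
        ENNReal.tsum_le_tsum fun n => ENNReal.ofReal_le_ofReal (hterm n)
    _ = ENNReal.ofReal (∑' n : ℕ, Real.pi * ‖taylorCoeff h (n + 1)‖ ^ 2) :=
        (ENNReal.ofReal_tsum_of_nonneg (fun n => by positivity) (hs1.mul_left _)).symm
    _ ≤ _ := by
        refine ENNReal.ofReal_le_ofReal ?_
        rw [tsum_mul_left]
        gcongr
        refine le_trans ?_ (hsum.tsum_le_of_sum_le hfin)
        rw [hsum.tsum_eq_zero_add]
        linarith [sq_nonneg ‖taylorCoeff h 0‖]

/-- Bounded holomorphic functions have bounded mean oscillation. -/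
lemma lintegral_garsia_le_of_norm_le {E : ℂ → ℂ} (hE : DifferentiableOn ℂ E unitDisc) {M : ℝ}
    (hM : ∀ z ∈ unitDisc, ‖E z‖ ≤ M) {a : ℂ} (ha : a ∈ unitDisc) :
    ∫⁻ z in unitDisc, ENNReal.ofReal (‖deriv E z‖ ^ 2 * (1 - ‖mobius a z‖ ^ 2)) ≤
      ENNReal.ofReal (Real.pi * (4 * M ^ 2)) := by
  have hK := differentiableOn_szegoKernel ha
  have ha1 := one_sub_sq_norm_pos ha
  have hM0 : 0 ≤ M := (norm_nonneg _).trans (hM a ha)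
  have hmem : ∀ r : ℝ, 0 ≤ r → r < 1 → ∀ θ : ℝ, (r * Complex.exp (θ * I) : ℂ) ∈ unitDisc := by
    intro r hr0 hr1 θ
    simpa [mem_unitDisc, Complex.norm_exp_ofReal_mul_I, abs_of_nonneg hr0] using hr1
  have hKc : ∀ r : ℝ, 0 ≤ r → r < 1 →
      Continuous fun θ : ℝ => szegoKernel a (r * Complex.exp (θ * I)) := fun r hr0 hr1 =>
    hK.continuousOn.comp_continuous (by fun_prop) (hmem r hr0 hr1)
  have hEc : ∀ r : ℝ, 0 ≤ r → r < 1 →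
      Continuous fun θ : ℝ => E (r * Complex.exp (θ * I)) := fun r hr0 hr1 =>
    hE.continuousOn.comp_continuous (by fun_prop) (hmem r hr0 hr1)
  have b1 := lintegral_deriv_le_of_circle hK (B := (1 - ‖a‖ ^ 2)⁻¹)
    fun r hr0 hr1 => circle_szegoKernel_le ha hr0 hr1
  have b2 := lintegral_deriv_le_of_circle (hE.mul hK) (B := M ^ 2 * (1 - ‖a‖ ^ 2)⁻¹) (by
    intro r hr0 hr1
    calc _ ≤ ∫ θ in (-Real.pi)..Real.pi,
          M ^ 2 * ‖szegoKernel a (r * Complex.exp (θ * I))‖ ^ 2 := by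
          refine intervalIntegral.integral_mono_on (by linarith [Real.pi_pos])
            ((((hEc r hr0 hr1).mul (hKc r hr0 hr1)).norm.pow 2).intervalIntegrable _ _)
            ((continuous_const.mul ((hKc r hr0 hr1).norm.pow 2)).intervalIntegrable _ _)
            fun θ _ => ?_
          simp only [Pi.mul_apply]
          rw [norm_mul, mul_pow]
          gcongr
          exact hM _ (hmem r hr0 hr1 θ)
      _ ≤ _ := by
          rw [intervalIntegral.integral_const_mul]
          have := mul_le_mul_of_nonneg_left (circle_szegoKernel_le ha hr0 hr1) (sq_nonneg M)
          linarith)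
  have hpt : ∀ z ∈ unitDisc,
      ENNReal.ofReal (‖deriv E z‖ ^ 2 * (1 - ‖mobius a z‖ ^ 2)) ≤
      ENNReal.ofReal (2 * (1 - ‖a‖ ^ 2)) *
        ENNReal.ofReal (‖deriv (E * szegoKernel a) z‖ ^ 2 * (1 - ‖z‖ ^ 2)) +
      ENNReal.ofReal (2 * (1 - ‖a‖ ^ 2) * M ^ 2) *
        ENNReal.ofReal (‖deriv (szegoKernel a) z‖ ^ 2 * (1 - ‖z‖ ^ 2)) := by
    intro z hz
    have hz1 := one_sub_sq_norm_pos hz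
    rw [← ENNReal.ofReal_mul (by positivity), ← ENNReal.ofReal_mul (by positivity),
      ← ENNReal.ofReal_add (by positivity) (by positivity), one_sub_sq_norm_mobius ha hz]
    refine ENNReal.ofReal_le_ofReal ?_
    have hd : deriv E z * szegoKernel a z =
        deriv (E * szegoKernel a) z - E z * deriv (szegoKernel a) z := by
      rw [deriv_mul (hE.differentiableAt (isOpen_unitDisc.mem_nhds hz))
        (hK.differentiableAt (isOpen_unitDisc.mem_nhds hz))]
      ring
    have h1 : ‖deriv E z‖ * ‖szegoKernel a z‖ ≤
        ‖deriv (E * szegoKernel a) z‖ + M * ‖deriv (szegoKernel a) z‖ := by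
      rw [← norm_mul, hd]
      refine (norm_sub_le _ _).trans ?_
      rw [norm_mul]
      gcongr
      exact hM z hz
    have h2 : (‖deriv E z‖ * ‖szegoKernel a z‖) ^ 2 ≤
        2 * ‖deriv (E * szegoKernel a) z‖ ^ 2 + 2 * M ^ 2 * ‖deriv (szegoKernel a) z‖ ^ 2 := by
      refine (pow_le_pow_left₀ (by positivity) h1 2).trans ?_
      nlinarith [sq_nonneg (‖deriv (E * szegoKernel a) z‖ - M * ‖deriv (szegoKernel a) z‖)]
    have h3 := mul_le_mul_of_nonneg_left h2 (mul_pos ha1 hz1).le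
    linarith
  have hm : Measurable fun z =>
      ENNReal.ofReal (2 * (1 - ‖a‖ ^ 2) * M ^ 2) *
        ENNReal.ofReal (‖deriv (szegoKernel a) z‖ ^ 2 * (1 - ‖z‖ ^ 2)) := by
    have := measurable_deriv (szegoKernel a)
    fun_prop
  calc _ ≤ _ := setLIntegral_mono' isOpen_unitDisc.measurableSet hpt
    _ = _ := lintegral_add_right _ hm
    _ = _ := by
      rw [lintegral_const_mul' _ _ ENNReal.ofReal_ne_top,
        lintegral_const_mul' _ _ ENNReal.ofReal_ne_top]
    _ ≤ _ := add_le_add (mul_le_mul_right b2 _) (mul_le_mul_right b1 _)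
    _ = _ := by
      rw [← ENNReal.ofReal_mul (by positivity), ← ENNReal.ofReal_mul (by positivity),
        ← ENNReal.ofReal_add (by positivity) (by positivity)]
      congr 1
      field_simp
      ring

/-- The integrand of the Garsia seminorm is nonnegative on the disc. -/
lemma garsia_nonneg (f : ℂ → ℂ) {a z : ℂ} (ha : a ∈ unitDisc) (hz : z ∈ unitDisc) :
    0 ≤ ‖deriv f z‖ ^ 2 * (1 - ‖mobius a z‖ ^ 2) := by
  rw [one_sub_sq_norm_mobius ha hz]
  have := one_sub_sq_norm_pos ha
  have := one_sub_sq_norm_pos hz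
  positivity

lemma integrableOn_garsia {f : ℂ → ℂ} {a : ℂ} (ha : a ∈ unitDisc)
    (h : ∫⁻ z in unitDisc, ENNReal.ofReal (‖deriv f z‖ ^ 2 * (1 - ‖mobius a z‖ ^ 2)) ≠ ⊤) :
    IntegrableOn (fun z => ‖deriv f z‖ ^ 2 * (1 - ‖mobius a z‖ ^ 2)) unitDisc := by
  have hm : Measurable fun z => ‖deriv f z‖ ^ 2 * (1 - ‖mobius a z‖ ^ 2) := by
    have := measurable_deriv f
    unfold mobius
    fun_prop
  refine ⟨hm.aestronglyMeasurable, ?_⟩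
  rw [hasFiniteIntegral_iff_ofReal]
  · exact lt_top_iff_ne_top.2 h
  · exact (ae_restrict_iff' isOpen_unitDisc.measurableSet).2
      (ae_of_all _ fun z hz => garsia_nonneg f ha hz)

lemma bmoaSemi_le_of_lintegral {f : ℂ → ℂ} {a : ℂ} (ha : a ∈ unitDisc) {B : ℝ} (hB : 0 ≤ B)
    (h : ∫⁻ z in unitDisc, ENNReal.ofReal (‖deriv f z‖ ^ 2 * (1 - ‖mobius a z‖ ^ 2)) ≤
      ENNReal.ofReal (Real.pi * B)) : bmoaSemi f a ≤ B := by
  have hint := integrableOn_garsia ha (ne_top_of_le_ne_top ENNReal.ofReal_ne_top h)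
  rw [bmoaSemi, inv_mul_le_iff₀ Real.pi_pos]
  rw [← ofReal_integral_eq_lintegral_ofReal hint
    ((ae_restrict_iff' isOpen_unitDisc.measurableSet).2
      (ae_of_all _ fun z hz => garsia_nonneg f ha hz))] at h
  exact (ENNReal.ofReal_le_ofReal_iff (by positivity)).1 h

/-- A holomorphic function with small imaginary part is comparable with a bounded function. -/
lemma norm_deriv_le_of_im_le {F : ℂ → ℂ} (hF : DifferentiableOn ℂ F unitDisc) {δ : ℝ} (hδ : 0 < δ)
    (him : ∀ z ∈ unitDisc, |(F z).im| ≤ δ) :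
    ∃ E : ℂ → ℂ, DifferentiableOn ℂ E unitDisc ∧ (∀ z ∈ unitDisc, ‖E z‖ ≤ Real.exp 1) ∧
      ∀ z ∈ unitDisc, ‖deriv F z‖ ≤ Real.exp 1 * δ * ‖deriv E z‖ := by
  have hc : ((δ : ℂ)⁻¹ * I) ≠ 0 := by simp [hδ.ne']
  have hnorm : ∀ z, ‖Complex.exp ((δ : ℂ)⁻¹ * I * F z)‖ = Real.exp (-(δ⁻¹ * (F z).im)) := by
    intro z
    rw [Complex.norm_exp, ← Complex.ofReal_inv]
    congr 1
    simp
  have habs : ∀ z ∈ unitDisc, |δ⁻¹ * (F z).im| ≤ 1 := by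
    intro z hz
    rw [abs_mul, abs_of_pos (inv_pos.2 hδ), inv_mul_le_iff₀ hδ, mul_one]
    exact him z hz
  refine ⟨fun z => Complex.exp ((δ : ℂ)⁻¹ * I * F z), (hF.const_mul _).cexp, fun z hz => ?_,
    fun z hz => ?_⟩
  · rw [hnorm]
    exact Real.exp_le_exp.2 (by linarith [(abs_le.1 (habs z hz)).1])
  · have hd : HasDerivAt (fun z => Complex.exp ((δ : ℂ)⁻¹ * I * F z))
        (Complex.exp ((δ : ℂ)⁻¹ * I * F z) * ((δ : ℂ)⁻¹ * I * deriv F z)) z :=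
      (((hF.differentiableAt (isOpen_unitDisc.mem_nhds hz)).hasDerivAt).const_mul _).cexp
    rw [hd.deriv, norm_mul, hnorm, norm_mul, norm_mul, norm_I, norm_inv, Complex.norm_real,
      Real.norm_of_nonneg hδ.le]
    have h1 : 1 ≤ Real.exp 1 * Real.exp (-(δ⁻¹ * (F z).im)) := by
      rw [← Real.exp_add]
      exact Real.one_le_exp (by linarith [(abs_le.1 (habs z hz)).2])
    calc ‖deriv F z‖ ≤ Real.exp 1 * Real.exp (-(δ⁻¹ * (F z).im)) * ‖deriv F z‖ :=
          le_mul_of_one_le_left (norm_nonneg _) h1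
      _ = _ := by field_simp

lemma lintegral_garsia_le_of_im_le {F : ℂ → ℂ} (hF : DifferentiableOn ℂ F unitDisc) {δ : ℝ}
    (hδ : 0 < δ) (him : ∀ z ∈ unitDisc, |(F z).im| ≤ δ) {a : ℂ} (ha : a ∈ unitDisc) :
    ∫⁻ z in unitDisc, ENNReal.ofReal (‖deriv F z‖ ^ 2 * (1 - ‖mobius a z‖ ^ 2)) ≤
      ENNReal.ofReal (Real.pi * (2 * Real.exp 1 ^ 2 * δ) ^ 2) := by
  obtain ⟨E, hE, hEb, hFE⟩ := norm_deriv_le_of_im_le hF hδ him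
  have h := lintegral_garsia_le_of_norm_le hE hEb ha
  calc _ ≤ ∫⁻ z in unitDisc, ENNReal.ofReal ((Real.exp 1 * δ) ^ 2) *
        ENNReal.ofReal (‖deriv E z‖ ^ 2 * (1 - ‖mobius a z‖ ^ 2)) := by
        refine setLIntegral_mono' isOpen_unitDisc.measurableSet fun z hz => ?_
        rw [← ENNReal.ofReal_mul (by positivity)]
        refine ENNReal.ofReal_le_ofReal ?_
        have h1 := one_sub_sq_norm_mobius ha hz
        have h2 : 0 ≤ 1 - ‖mobius a z‖ ^ 2 := by
          rw [h1]
          have := one_sub_sq_norm_pos ha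
          have := one_sub_sq_norm_pos hz
          positivity
        rw [← mul_assoc, ← mul_pow]
        gcongr
        exact hFE z hz
    _ = ENNReal.ofReal ((Real.exp 1 * δ) ^ 2) * _ :=
        lintegral_const_mul' _ _ ENNReal.ofReal_ne_top
    _ ≤ ENNReal.ofReal ((Real.exp 1 * δ) ^ 2) * _ := mul_le_mul_right h _
    _ = _ := by
        rw [← ENNReal.ofReal_mul (by positivity)]
        congr 1
        ring

lemma bmoaSemi_le_of_im_le {F : ℂ → ℂ} (hF : DifferentiableOn ℂ F unitDisc) {δ : ℝ}
    (hδ : 0 < δ) (him : ∀ z ∈ unitDisc, |(F z).im| ≤ δ) {a : ℂ} (ha : a ∈ unitDisc) :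
    bmoaSemi F a ≤ (2 * Real.exp 1 ^ 2 * δ) ^ 2 :=
  bmoaSemi_le_of_lintegral ha (sq_nonneg _) (lintegral_garsia_le_of_im_le hF hδ him ha)

lemma blochSemi_le_of_im_le {F : ℂ → ℂ} (hF : DifferentiableOn ℂ F unitDisc) {δ : ℝ}
    (hδ : 0 < δ) (him : ∀ z ∈ unitDisc, |(F z).im| ≤ δ) {z : ℂ} (hz : z ∈ unitDisc) :
    blochSemi F z ≤ 2 * Real.exp 1 ^ 2 * δ := by
  obtain ⟨E, hE, hEb, hFE⟩ := norm_deriv_le_of_im_le hF hδ him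
  have hz1 := mem_unitDisc.1 hz
  have hball : Metric.ball z (1 - ‖z‖) ⊆ unitDisc := by
    intro w hw
    rw [Metric.mem_ball, dist_eq_norm] at hw
    rw [mem_unitDisc]
    linarith [norm_le_insert' w z]
  have hmaps : MapsTo E (Metric.ball z (1 - ‖z‖)) (Metric.closedBall (E z) (2 * Real.exp 1)) := by
    intro w hw
    rw [Metric.mem_closedBall, dist_eq_norm]
    linarith [norm_sub_le (E w) (E z), hEb w (hball hw), hEb z hz]
  have hdE : ‖deriv E z‖ * (1 - ‖z‖ ^ 2) ≤ 2 * Real.exp 1 := by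
    have key : ∀ r : ℝ, 0 < r → r < 1 - ‖z‖ → ‖deriv E z‖ * r ≤ Real.exp 1 := by
      intro r hr0 hr1
      have hcl : Metric.closedBall z r ⊆ unitDisc :=
        (Metric.closedBall_subset_ball hr1).trans hball
      have := Complex.norm_deriv_le_of_forall_mem_sphere_norm_le hr0
        (f := E) (c := z) (C := Real.exp 1)
        ((hE.mono hcl).diffContOnCl_ball (Subset.refl _))
        (fun w hw => hEb w (hcl (Metric.sphere_subset_closedBall hw)))
      rwa [le_div_iff₀ hr0] at this
    have h1 : ‖deriv E z‖ * (1 - ‖z‖) ≤ Real.exp 1 := by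
      have hlim : Tendsto (fun r : ℝ => ‖deriv E z‖ * r) (nhdsWithin (1 - ‖z‖) (Iio (1 - ‖z‖)))
          (nhds (‖deriv E z‖ * (1 - ‖z‖))) :=
        ((continuous_const.mul continuous_id).tendsto _).mono_left nhdsWithin_le_nhds
      refine le_of_tendsto hlim ?_
      filter_upwards [Ioo_mem_nhdsLT (show (0 : ℝ) < 1 - ‖z‖ by linarith)] with r hr
      exact key r hr.1 hr.2
    have h0 : 0 ≤ ‖deriv E z‖ * (1 - ‖z‖) := mul_nonneg (norm_nonneg _) (by linarith)
    nlinarith [norm_nonneg z]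
  have h1 := one_sub_sq_norm_pos hz
  calc blochSemi F z ≤ Real.exp 1 * δ * ‖deriv E z‖ * (1 - ‖z‖ ^ 2) := by
        rw [blochSemi]
        gcongr
        exact hFE z hz
    _ ≤ Real.exp 1 * δ * (2 * Real.exp 1) := by
        rw [mul_assoc]
        gcongr
    _ = _ := by ring

/-- The Garsia seminorm dominates the Bloch quantity. -/
lemma sq_blochSemi_le {f : ℂ → ℂ} (hf : DifferentiableOn ℂ f unitDisc) {a : ℂ} (ha : a ∈ unitDisc)
    (hint : IntegrableOn (fun z => ‖deriv f z‖ ^ 2 * (1 - ‖mobius a z‖ ^ 2)) unitDisc) :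
    blochSemi f a ^ 2 ≤ 2 * bmoaSemi f a := by
  have ha1 := one_sub_sq_norm_pos ha
  have haz := mem_unitDisc.1 ha
  set H : ℂ → ℂ := fun z => deriv f z * szegoKernel a z with hHdef
  have hH : DifferentiableOn ℂ H unitDisc :=
    (hf.deriv isOpen_unitDisc).mul (differentiableOn_szegoKernel ha)
  have hae : 0 ≤ᵐ[volume.restrict unitDisc]
      fun z => ‖deriv f z‖ ^ 2 * (1 - ‖mobius a z‖ ^ 2) :=
    (ae_restrict_iff' isOpen_unitDisc.measurableSet).2
      (ae_of_all _ fun z hz => garsia_nonneg f ha hz)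
  set S : ℝ := bmoaSemi f a with hS
  have hI : ∫⁻ z in unitDisc, ENNReal.ofReal (‖deriv f z‖ ^ 2 * (1 - ‖mobius a z‖ ^ 2)) =
      ENNReal.ofReal (Real.pi * S) := by
    rw [← ofReal_integral_eq_lintegral_ofReal hint hae, hS, bmoaSemi,
      mul_inv_cancel_left₀ Real.pi_ne_zero]
  have hI2 : ∫⁻ z in unitDisc, ENNReal.ofReal (‖deriv f z‖ ^ 2 * (1 - ‖mobius a z‖ ^ 2)) =
      ENNReal.ofReal (1 - ‖a‖ ^ 2) *
        ∫⁻ z in unitDisc, ENNReal.ofReal (‖H z‖ ^ 2 * (1 - ‖z‖ ^ 2)) := by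
    rw [← lintegral_const_mul' _ _ ENNReal.ofReal_ne_top]
    refine setLIntegral_congr_fun isOpen_unitDisc.measurableSet fun z hz => ?_
    rw [← ENNReal.ofReal_mul ha1.le, one_sub_sq_norm_mobius ha hz, hHdef, norm_mul]
    congr 1
    ring
  have hS0 : 0 ≤ S := mul_nonneg (by positivity)
    (setIntegral_nonneg isOpen_unitDisc.measurableSet fun z hz => garsia_nonneg f ha hz)
  set b := taylorCoeff H
  have hfin : ∀ s : Finset ℕ,
      (1 - ‖a‖ ^ 2) * ∑ n ∈ s, ‖b n‖ ^ 2 / ((n + 1) * (n + 2)) ≤ S := by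
    intro s
    rw [hI, lintegral_sq_mul_weight hH] at hI2
    have h1 := ENNReal.sum_le_tsum (f := fun n : ℕ =>
      ENNReal.ofReal (Real.pi * (‖b n‖ ^ 2 / ((n + 1) * (n + 2))))) s
    rw [← ENNReal.ofReal_sum_of_nonneg (fun n _ => by positivity), ← Finset.mul_sum] at h1
    have h2 := mul_le_mul_right h1 (ENNReal.ofReal (1 - ‖a‖ ^ 2))
    rw [← hI2, ← ENNReal.ofReal_mul ha1.le, ENNReal.ofReal_le_ofReal_iff (by positivity)] at h2
    refine le_of_mul_le_mul_left ?_ Real.pi_pos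
    linarith
  have hx : ‖a‖ ^ 2 < 1 := by linarith
  have hgeo : ∀ s : Finset ℕ, ∑ n ∈ s, ((n + 1) * (n + 2)) * (‖a‖ ^ 2) ^ n ≤
      2 / (1 - ‖a‖ ^ 2) ^ 3 := by
    intro s
    have h1 := (hasSum_choose_mul_geometric_of_norm_lt_one (𝕜 := ℝ) 2
      (r := ‖a‖ ^ 2) (by rwa [Real.norm_of_nonneg (sq_nonneg _)])).mul_left 2
    have h2 := sum_le_hasSum s (fun n _ => by positivity) h1
    refine le_trans (le_of_eq (Finset.sum_congr rfl fun n _ => ?_)) (h2.trans (le_of_eq ?_))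
    · rw [Nat.cast_choose_two]
      push_cast
      ring
    · ring
  have hpart : ∀ s : Finset ℕ, ‖∑ n ∈ s, b n * a ^ n‖ ^ 2 ≤ 2 * S / (1 - ‖a‖ ^ 2) ^ 4 := by
    intro s
    have h1 : ‖∑ n ∈ s, b n * a ^ n‖ ≤ ∑ n ∈ s,
        (‖b n‖ / Real.sqrt ((n + 1) * (n + 2))) * (Real.sqrt ((n + 1) * (n + 2)) * ‖a‖ ^ n) := by
      refine (norm_sum_le _ _).trans (le_of_eq (Finset.sum_congr rfl fun n _ => ?_))
      have : Real.sqrt (((n : ℝ) + 1) * (n + 2)) ≠ 0 := by positivity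
      rw [norm_mul, norm_pow]
      field_simp
    have h2 := (pow_le_pow_left₀ (norm_nonneg _) h1 2).trans
      (Finset.sum_mul_sq_le_sq_mul_sq s _ _)
    have e1 : ∀ n : ℕ, (‖b n‖ / Real.sqrt ((n + 1) * (n + 2))) ^ 2 =
        ‖b n‖ ^ 2 / ((n + 1) * (n + 2)) := fun n => by
      rw [div_pow, Real.sq_sqrt (by positivity)]
    have e2 : ∀ n : ℕ, (Real.sqrt ((n + 1) * (n + 2)) * ‖a‖ ^ n) ^ 2 =
        ((n + 1) * (n + 2)) * (‖a‖ ^ 2) ^ n := fun n => by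
      rw [mul_pow, Real.sq_sqrt (by positivity), ← pow_mul, ← pow_mul, mul_comm n]
    simp only [e1, e2] at h2
    refine h2.trans ?_
    calc _ ≤ (S / (1 - ‖a‖ ^ 2)) * (2 / (1 - ‖a‖ ^ 2) ^ 3) := by
          refine mul_le_mul ?_ (hgeo s) (Finset.sum_nonneg fun n _ => by positivity)
            (by positivity)
          rw [le_div_iff₀ ha1, mul_comm]
          exact hfin s
      _ = _ := by
          field_simp
  have hlim : Tendsto (fun s : Finset ℕ => ‖∑ n ∈ s, b n * a ^ n‖ ^ 2) atTop
      (nhds (‖H a‖ ^ 2)) := ((hasSum_taylorCoeff hH ha).norm.pow 2 :)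
  have hHa := le_of_tendsto' hlim hpart
  have hka : ‖szegoKernel a a‖ = (1 - ‖a‖ ^ 2)⁻¹ := by
    rw [szegoKernel, norm_inv, mul_comm, Complex.mul_conj, Complex.normSq_eq_norm_sq,
      ← Complex.ofReal_one, ← Complex.ofReal_sub, Complex.norm_real, Real.norm_of_nonneg ha1.le]
  rw [hHdef, norm_mul, hka, le_div_iff₀ (by positivity)] at hHa
  rw [blochSemi]
  calc _ = (‖deriv f a‖ * (1 - ‖a‖ ^ 2)⁻¹) ^ 2 * (1 - ‖a‖ ^ 2) ^ 4 := by field_simp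
    _ ≤ _ := hHa

lemma mobius_self (a : ℂ) : mobius a a = 0 := by simp [mobius]

lemma mobius_mem {a z : ℂ} (ha : a ∈ unitDisc) (hz : z ∈ unitDisc) : mobius a z ∈ unitDisc := by
  have h := one_sub_sq_norm_mobius ha hz
  have h0 : szegoKernel a z ≠ 0 := inv_ne_zero (one_sub_conj_mul_ne_zero ha hz)
  have h1 := one_sub_sq_norm_pos ha
  have h2 := one_sub_sq_norm_pos hz
  have h3 : 0 < 1 - ‖mobius a z‖ ^ 2 := by rw [h]; positivity
  rw [mem_unitDisc]
  nlinarith [norm_nonneg (mobius a z)]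

lemma mobius_mobius {a z : ℂ} (ha : a ∈ unitDisc) (hz : z ∈ unitDisc) :
    mobius a (mobius a z) = z := by
  have h := one_sub_conj_mul_ne_zero ha hz
  have h2 := one_sub_conj_mul_ne_zero ha (mobius_mem ha hz)
  have e : mobius a z * (1 - (starRingEnd ℂ) a * z) = a - z := div_mul_cancel₀ _ h
  rw [mobius, div_eq_iff h2]
  linear_combination -e

lemma differentiableOn_mobius {a : ℂ} (ha : a ∈ unitDisc) :
    DifferentiableOn ℂ (mobius a) unitDisc :=
  DifferentiableOn.div (by fun_prop) (by fun_prop) fun _ hz => one_sub_conj_mul_ne_zero ha hz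

/-- The Schwarz–Pick lemma. -/
lemma norm_mobius_le {ψ : ℂ → ℂ} (hd : DifferentiableOn ℂ ψ unitDisc)
    (hm : MapsTo ψ unitDisc unitDisc) {a z : ℂ} (ha : a ∈ unitDisc) (hz : z ∈ unitDisc) :
    ‖mobius (ψ a) (ψ z)‖ ≤ ‖mobius a z‖ := by
  have hma : MapsTo (mobius a) unitDisc unitDisc := fun w hw => mobius_mem ha hw
  have hmψ : MapsTo (mobius (ψ a)) unitDisc unitDisc := fun w hw => mobius_mem (hm ha) hw
  have hG : DifferentiableOn ℂ (fun w => mobius (ψ a) (ψ (mobius a w))) unitDisc :=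
    (differentiableOn_mobius (hm ha)).comp (hd.comp (differentiableOn_mobius ha) hma)
      (hm.comp hma)
  have h0 : mobius a 0 = a := by simp [mobius]
  have h := Complex.norm_le_norm_of_mapsTo_ball (f := fun w => mobius (ψ a) (ψ (mobius a w))) (R := 1)
    (z := mobius a z) hG
    (fun w hw => Metric.ball_subset_closedBall (hmψ (hm (hma hw))))
    (by simp only [h0, mobius_self]) (mem_unitDisc.1 (mobius_mem ha hz))
  simpa only [mobius_mobius ha hz] using h

lemma norm_sub_le_two_mul_norm_mobius {a z : ℂ} (ha : a ∈ unitDisc) (hz : z ∈ unitDisc) :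
    ‖a - z‖ ≤ 2 * ‖mobius a z‖ := by
  have h := one_sub_conj_mul_ne_zero ha hz
  have h1 : a - z = (1 - (starRingEnd ℂ) a * z) * mobius a z :=
    (mul_div_cancel₀ _ h).symm
  rw [h1, norm_mul]
  gcongr
  refine (norm_sub_le _ _).trans ?_
  rw [norm_one]
  linarith [norm_conj_mul_lt_one ha hz]

lemma mobius_eq_zero_iff {a z : ℂ} (ha : a ∈ unitDisc) (hz : z ∈ unitDisc) :
    mobius a z = 0 ↔ a = z := by
  rw [mobius, div_eq_zero_iff, or_iff_left (one_sub_conj_mul_ne_zero ha hz), sub_eq_zero]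

/-- Dilations strictly contract the pseudo-hyperbolic distance. -/
lemma norm_mobius_smul_lt {r : ℝ} (hr0 : 0 < r) (hr1 : r < 1) {u v : ℂ} (hu : u ∈ unitDisc)
    (hv : v ∈ unitDisc) (huv : u ≠ v) : ‖mobius (r * u) (r * v)‖ < ‖mobius u v‖ := by
  set s := (starRingEnd ℂ) u * v with hs
  have hs1 : ‖s‖ < 1 := norm_conj_mul_lt_one hu hv
  have h1 : 0 < ‖1 - s‖ := norm_pos_iff.2 (one_sub_conj_mul_ne_zero hu hv)
  have hlt : r * ‖1 - s‖ < ‖1 - (r : ℂ) ^ 2 * s‖ := by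
    refine lt_of_pow_lt_pow_left₀ 2 (norm_nonneg _) ?_
    have e : ‖1 - (r : ℂ) ^ 2 * s‖ ^ 2 - (r * ‖1 - s‖) ^ 2 = (1 - r ^ 2) * (1 - r ^ 2 * ‖s‖ ^ 2) := by
      rw [mul_pow]
      simp only [← Complex.normSq_eq_norm_sq, Complex.normSq_apply, pow_two (r : ℂ), Complex.sub_re,
        Complex.sub_im, Complex.one_re, Complex.one_im, Complex.mul_re, Complex.mul_im,
        Complex.ofReal_re, Complex.ofReal_im]
      ring
    have h2 : 0 < 1 - r ^ 2 := by nlinarith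
    have h3 : 0 < 1 - r ^ 2 * ‖s‖ ^ 2 := by
      have : ‖s‖ ^ 2 < 1 := by nlinarith [norm_nonneg s]
      nlinarith [sq_nonneg ‖s‖, sq_nonneg r]
    have := mul_pos h2 h3
    linarith
  have e1 : mobius (r * u) (r * v) = r * (u - v) / (1 - (r : ℂ) ^ 2 * s) := by
    rw [mobius, map_mul, Complex.conj_ofReal, hs]
    congr 1 <;> ring
  rw [e1, mobius, ← hs, norm_div, norm_div, norm_mul, Complex.norm_real,
    Real.norm_of_nonneg hr0.le, div_lt_div_iff₀ (lt_trans (mul_pos hr0 h1) hlt) h1]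
  have := mul_lt_mul_of_pos_left hlt (norm_pos_iff.2 (sub_ne_zero.2 huv))
  linarith

/-- A dilated self-map of the disc has a fixed point. -/
lemma exists_fixedPoint_dilation {ψ : ℂ → ℂ} (hd : DifferentiableOn ℂ ψ unitDisc)
    (hm : MapsTo ψ unitDisc unitDisc) {r : ℝ} (hr0 : 0 < r) (hr1 : r < 1) :
    ∃ p ∈ unitDisc, (r : ℂ) * ψ p = p := by
  have hsub : Metric.closedBall (0 : ℂ) r ⊆ unitDisc := Metric.closedBall_subset_ball hr1
  have hmr : ∀ z ∈ unitDisc, (r : ℂ) * ψ z ∈ Metric.closedBall (0 : ℂ) r := by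
    intro z hz
    have := mem_unitDisc.1 (hm hz)
    rw [mem_closedBall_zero_iff, norm_mul, Complex.norm_real, Real.norm_of_nonneg hr0.le]
    nlinarith
  have hc : ContinuousOn (fun z => ‖mobius z (r * ψ z)‖) (Metric.closedBall (0 : ℂ) r) := by
    have h1 : ContinuousOn ψ (Metric.closedBall (0 : ℂ) r) := hd.continuousOn.mono hsub
    refine ContinuousOn.norm (ContinuousOn.div (by fun_prop) ?_ fun z hz =>
      one_sub_conj_mul_ne_zero (hsub hz) (hsub (hmr z (hsub hz))))
    exact continuousOn_const.sub ((Complex.continuous_conj.continuousOn).mul (by fun_prop))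
  obtain ⟨z, hz, hmin⟩ := (isCompact_closedBall (0 : ℂ) r).exists_isMinOn
    ⟨0, Metric.mem_closedBall_self hr0.le⟩ hc
  refine ⟨z, hsub hz, ?_⟩
  by_contra hne
  set w := (r : ℂ) * ψ z with hw
  have hwm : w ∈ Metric.closedBall (0 : ℂ) r := hmr z (hsub hz)
  have hle : ‖mobius z w‖ ≤ ‖mobius w (r * ψ w)‖ := hmin hwm
  have hpos : 0 < ‖mobius z w‖ := norm_pos_iff.2 fun h =>
    hne ((mobius_eq_zero_iff (hsub hz) (hsub hwm)).1 h).symm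
  have hlt : ‖mobius w (r * ψ w)‖ < ‖mobius z w‖ := by
    by_cases h : ψ z = ψ w
    · rw [hw, ← hw, ← h, ← hw, mobius_self, norm_zero]
      exact hpos
    · exact (norm_mobius_smul_lt hr0 hr1 (hm (hsub hz)) (hm (hsub hwm)) h).trans_le
        (norm_mobius_le hd hm (hsub hz) (hsub hwm))
  exact absurd hle (not_le.2 hlt)

/-- The function whose superlevel sets are the horodiscs at `p` when `|p| = 1`, and the
pseudo-hyperbolic discs about `p` when `|p| < 1`. -/
def horo (p z : ℂ) : ℝ := (1 - ‖z‖ ^ 2) * ‖szegoKernel p z‖ ^ 2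

lemma one_sub_conj_mul_ne_zero' {p z : ℂ} (hp : ‖p‖ ≤ 1) (hz : z ∈ unitDisc) :
    1 - (starRingEnd ℂ) p * z ≠ 0 := by
  intro h
  have h1 : ‖(starRingEnd ℂ) p * z‖ = 1 := by rw [← sub_eq_zero.1 h, norm_one]
  rw [norm_mul, RCLike.norm_conj] at h1
  rw [mem_unitDisc] at hz
  nlinarith [norm_nonneg z]

lemma tendsto_horo {ι : Type*} {l : Filter ι} {u v : ι → ℂ} {p z : ℂ} (hp : ‖p‖ ≤ 1)
    (hz : z ∈ unitDisc) (hu : Tendsto u l (nhds p)) (hv : Tendsto v l (nhds z)) :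
    Tendsto (fun i => horo (u i) (v i)) l (nhds (horo p z)) := by
  have hu' : Tendsto (fun i => (starRingEnd ℂ) (u i)) l (nhds ((starRingEnd ℂ) p)) :=
    (Complex.continuous_conj.tendsto p).comp hu
  exact (tendsto_const_nhds.sub (hv.norm.pow 2)).mul
    (((tendsto_const_nhds.sub (hu'.mul hv)).inv₀ (one_sub_conj_mul_ne_zero' hp hz)).norm.pow 2)

/-- Wolff's lemma. -/
lemma exists_horo_le {ψ : ℂ → ℂ} (hd : DifferentiableOn ℂ ψ unitDisc)
    (hm : MapsTo ψ unitDisc unitDisc) :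
    ∃ p : ℂ, ‖p‖ ≤ 1 ∧ ∀ z ∈ unitDisc, horo p z ≤ horo p (ψ z) := by
  have hr0 : ∀ n : ℕ, 0 < (1 - 1 / ((n : ℝ) + 2)) := fun n => by
    rw [sub_pos, div_lt_one (by positivity)]
    linarith [(Nat.cast_nonneg n : (0 : ℝ) ≤ n)]
  have hr1 : ∀ n : ℕ, (1 - 1 / ((n : ℝ) + 2)) < 1 := fun n => by
    have : 0 < 1 / ((n : ℝ) + 2) := by positivity
    linarith
  choose p hp hfix using fun n : ℕ => exists_fixedPoint_dilation hd hm (hr0 n) (hr1 n)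
  have hpc : ∀ n, p n ∈ Metric.closedBall (0 : ℂ) 1 := fun n => Metric.ball_subset_closedBall (hp n)
  obtain ⟨q, hq, σ, hσ, hlim⟩ := (isCompact_closedBall (0 : ℂ) 1).tendsto_subseq hpc
  have hq1 : ‖q‖ ≤ 1 := by simpa using hq
  refine ⟨q, hq1, fun z hz => ?_⟩
  have hrlim : Tendsto (fun n : ℕ => (1 - 1 / ((n : ℝ) + 2))) atTop (nhds 1) := by
    have : Tendsto (fun n : ℕ => 1 / ((n : ℝ) + 2)) atTop (nhds 0) :=
      tendsto_const_nhds.div_atTop (tendsto_atTop_add_const_right _ _ tendsto_natCast_atTop_atTop)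
    simpa using tendsto_const_nhds.sub this
  have hv : Tendsto (fun n => ((1 - 1 / ((σ n : ℝ) + 2) : ℝ) : ℂ) * ψ z) atTop (nhds (ψ z)) := by
    have := (Complex.continuous_ofReal.tendsto 1).comp (hrlim.comp hσ.tendsto_atTop)
    simpa using this.mul_const (ψ z)
  refine le_of_tendsto_of_tendsto' (tendsto_horo hq1 hz hlim tendsto_const_nhds)
    (tendsto_horo hq1 (hm hz) hlim hv) fun n => ?_
  set r := (1 - 1 / ((σ n : ℝ) + 2)) with hr
  have hrpos : 0 < r := hr0 _
  have hrlt : r < 1 := hr1 _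
  have hmr : MapsTo (fun w => (r : ℂ) * ψ w) unitDisc unitDisc := by
    intro w hw
    have := mem_unitDisc.1 (hm hw)
    rw [mem_unitDisc, norm_mul, Complex.norm_real, Real.norm_of_nonneg hrpos.le]
    nlinarith
  have hsp := norm_mobius_le (hd.const_mul (r : ℂ)) hmr (hp (σ n)) hz
  simp only [hr, hfix (σ n)] at hsp
  rw [← hr] at hsp
  have hsq := pow_le_pow_left₀ (norm_nonneg _) hsp 2
  have e1 := one_sub_sq_norm_mobius (hp (σ n)) hz
  have e2 := one_sub_sq_norm_mobius (hp (σ n)) (hmr hz)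
  have hpos := one_sub_sq_norm_pos (hp (σ n))
  simp only [Function.comp_apply, horo]
  refine le_of_mul_le_mul_left ?_ hpos
  simp only at e2
  linarith

namespace IsHoloSemigroup

variable {φ : ℝ → ℂ → ℂ}

lemma continuousWithinAt_zero (hφ : IsHoloSemigroup φ) {z : ℂ} (hz : z ∈ unitDisc) :
    ContinuousWithinAt (fun t => φ t z) (Ici 0) 0 := by
  rw [← continuousWithinAt_Ioi_iff_Ici, ContinuousWithinAt, hφ.2.1 z hz]
  exact (hφ.2.2.2 {z} (singleton_subset_iff.2 hz) isCompact_singleton).tendsto_at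
    (mem_singleton z)

lemma norm_sub_le (hφ : IsHoloSemigroup φ) {z : ℂ} (hz : z ∈ unitDisc) {s t : ℝ} (hs : 0 ≤ s)
    (ht : 0 ≤ t) : ‖φ t z - φ s z‖ ≤ 2 * ‖mobius z (φ |t - s| z)‖ := by
  wlog hst : s ≤ t generalizing s t
  · rw [norm_sub_rev, abs_sub_comm]
    exact this ht hs (le_of_not_ge hst)
  have h0 : 0 ≤ t - s := sub_nonneg.2 hst
  have hmem := (hφ.1 (t - s) h0).2 hz
  have hsemi : φ t z = φ s (φ (t - s) z) := by
    rw [← hφ.2.2.1 s hs (t - s) h0 z hz, add_sub_cancel]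
  rw [abs_of_nonneg h0, hsemi, norm_sub_rev]
  refine (norm_sub_le_two_mul_norm_mobius ((hφ.1 s hs).2 hz) ((hφ.1 s hs).2 hmem)).trans ?_
  gcongr
  exact norm_mobius_le (hφ.1 s hs).1 (hφ.1 s hs).2 hz hmem

lemma continuousOn_orbit (hφ : IsHoloSemigroup φ) {z : ℂ} (hz : z ∈ unitDisc) :
    ContinuousOn (fun t => φ t z) (Ici 0) := by
  intro s hs
  rw [ContinuousWithinAt, tendsto_iff_norm_sub_tendsto_zero]
  have habs : Tendsto (fun t : ℝ => |t - s|) (nhdsWithin s (Ici 0)) (nhdsWithin 0 (Ici 0)) := by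
    refine tendsto_nhdsWithin_iff.2 ⟨?_, Eventually.of_forall fun t => mem_Ici.2 (abs_nonneg _)⟩
    have : Continuous fun t : ℝ => |t - s| := by fun_prop
    simpa using (this.tendsto s).mono_left nhdsWithin_le_nhds
  have hmob : ContinuousAt (mobius z) z :=
    (differentiableOn_mobius hz).continuousOn.continuousAt (isOpen_unitDisc.mem_nhds hz)
  have horbit := (hφ.continuousWithinAt_zero hz).tendsto
  rw [hφ.2.1 z hz] at horbit
  have hlim := ((hmob.tendsto.comp (horbit.comp habs)).norm).const_mul 2
  rw [mobius_self, norm_zero, mul_zero] at hlim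
  refine tendsto_of_tendsto_of_tendsto_of_le_of_le' tendsto_const_nhds hlim
    (Eventually.of_forall fun t => norm_nonneg _) ?_
  filter_upwards [self_mem_nhdsWithin] with t ht
  exact hφ.norm_sub_le hz hs ht

lemma horo_le_iterate (hφ : IsHoloSemigroup φ) {p : ℂ} {h : ℝ} (hh : 0 ≤ h)
    (hp : ∀ z ∈ unitDisc, horo p z ≤ horo p (φ h z)) (k : ℕ) :
    ∀ z ∈ unitDisc, horo p z ≤ horo p (φ (k * h) z) := by
  induction k with
  | zero =>
    intro z hz
    simp [hφ.2.1 z hz]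
  | succ k ih =>
    intro z hz
    have hk : 0 ≤ (k : ℝ) * h := by positivity
    have e : ((k + 1 : ℕ) : ℝ) * h = h + k * h := by push_cast; ring
    rw [e, hφ.2.2.1 h hh _ hk z hz]
    exact (ih z hz).trans (hp _ ((hφ.1 _ hk).2 hz))

/-- All the maps of a semigroup share a Wolff point. -/
lemma exists_horo_le (hφ : IsHoloSemigroup φ) :
    ∃ p : ℂ, ‖p‖ ≤ 1 ∧ ∀ t : ℝ, 0 ≤ t → ∀ z ∈ unitDisc, horo p z ≤ horo p (φ t z) := by
  have hpos : ∀ n : ℕ, (0 : ℝ) ≤ 1 / ((n : ℝ) + 1) := fun n => by positivity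
  choose p hp1 hp using fun n : ℕ => _root_.exists_horo_le (hφ.1 _ (hpos n)).1 (hφ.1 _ (hpos n)).2
  obtain ⟨q, hq, σ, hσ, hlim⟩ := (isCompact_closedBall (0 : ℂ) 1).tendsto_subseq
    fun n => mem_closedBall_zero_iff.2 (hp1 n)
  rw [mem_closedBall_zero_iff] at hq
  refine ⟨q, hq, fun t ht z hz => ?_⟩
  have htime : Tendsto (fun n : ℕ => (⌊t * ((n : ℝ) + 1)⌋₊ : ℝ) * (1 / ((n : ℝ) + 1))) atTop
      (nhds t) := by
    have h := (tendsto_nat_floor_mul_div_atTop ht).comp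
      (tendsto_atTop_add_const_right atTop (1 : ℝ) (tendsto_natCast_atTop_atTop (R := ℝ)))
    simpa [Function.comp_def, div_eq_mul_inv] using h
  have htime' : Tendsto (fun n : ℕ => (⌊t * ((n : ℝ) + 1)⌋₊ : ℝ) * (1 / ((n : ℝ) + 1))) atTop
      (nhdsWithin t (Ici 0)) :=
    tendsto_nhdsWithin_iff.2 ⟨htime, Eventually.of_forall fun n => mem_Ici.2 (by positivity)⟩
  have horbit := (hφ.continuousOn_orbit hz t ht).tendsto.comp (htime'.comp hσ.tendsto_atTop)
  exact le_of_tendsto_of_tendsto' (tendsto_horo hq hz hlim tendsto_const_nhds)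
    (tendsto_horo hq ((hφ.1 t ht).2 hz) hlim horbit)
    fun n => hφ.horo_le_iterate (hpos _) (hp (σ n)) _ z hz

/-- The common Wolff point of a non-elliptic semigroup lies on the unit circle. -/
lemma exists_boundary_horo_le (hφ : IsHoloSemigroup φ) (hne : ¬ IsElliptic φ) :
    ∃ p : ℂ, ‖p‖ = 1 ∧ ∀ t : ℝ, 0 ≤ t → ∀ z ∈ unitDisc, horo p z ≤ horo p (φ t z) := by
  obtain ⟨p, hp1, hp⟩ := hφ.exists_horo_le
  refine ⟨p, hp1.eq_of_not_lt fun hlt => hne ?_, hp⟩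
  have hpD : p ∈ unitDisc := mem_unitDisc.2 hlt
  refine ⟨p, hpD, fun t ht => ?_⟩
  have hmem := (hφ.1 t ht).2 hpD
  have e1 := one_sub_sq_norm_mobius hpD hpD
  have e2 := one_sub_sq_norm_mobius hpD hmem
  have hpos := one_sub_sq_norm_pos hpD
  have h := mul_le_mul_of_nonneg_left (hp t ht p hpD) hpos.le
  rw [horo, horo] at h
  rw [mobius_self] at e1
  have h0 : ‖mobius p (φ t p)‖ ^ 2 ≤ 0 := by
    simp only [norm_zero] at e1
    linarith
  have h1 : ‖mobius p (φ t p)‖ = 0 := by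
    rw [← sq_eq_zero_iff]
    exact le_antisymm h0 (sq_nonneg _)
  exact ((mobius_eq_zero_iff hpD hmem).1 (norm_eq_zero.1 h1)).symm

end IsHoloSemigroup

/-- A holomorphic family with bounded imaginary parts may be integrated over the parameter. -/
lemma differentiableOn_integral_of_im_le {G : ℝ → ℂ → ℂ} {δ : ℝ} (hδ : 0 < δ)
    (hd : ∀ t, 0 ≤ t → DifferentiableOn ℂ (G t) unitDisc)
    (hc : ∀ z ∈ unitDisc, ContinuousOn (fun t => G t z) (Ici 0))
    (him : ∀ t, 0 ≤ t → ∀ z ∈ unitDisc, |(G t z).im| ≤ δ) :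
    DifferentiableOn ℂ (fun z => ∫ t in (0 : ℝ)..1, G t z) unitDisc := by
  intro w hw
  have hw1 := mem_unitDisc.1 hw
  have hI : uIoc (0 : ℝ) 1 ⊆ Ici 0 := by
    rw [uIoc_of_le zero_le_one]
    exact fun t ht => ht.1.le
  have hIcc : uIcc (0 : ℝ) 1 ⊆ Ici 0 := by
    rw [uIcc_of_le zero_le_one]
    exact fun t ht => ht.1
  have hmeas : ∀ z ∈ unitDisc,
      AEStronglyMeasurable (fun t => G t z) (volume.restrict (uIoc (0 : ℝ) 1)) := fun z hz =>
    ((hc z hz).mono hI).aestronglyMeasurable measurableSet_uIoc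
  set η : ℝ := (1 - ‖w‖) / 2 with hη
  have hη0 : 0 < η := by rw [hη]; linarith
  set ρ : ℝ := ‖w‖ + η with hρ
  have hρ1 : ρ < 1 := by rw [hρ, hη]; linarith
  have hball : ∀ z ∈ Metric.ball w η, ‖z‖ < ρ := by
    intro z hz
    have h1 : ‖z‖ ≤ ‖w‖ + ‖z - w‖ := by simpa using norm_add_le w (z - w)
    rw [mem_ball_iff_norm] at hz
    linarith
  have hballD : Metric.ball w η ⊆ unitDisc := fun z hz =>
    mem_unitDisc.2 ((hball z hz).trans hρ1)
  have hderiv : ∀ t, 0 ≤ t → ∀ z ∈ unitDisc, HasDerivAt (G t) (deriv (G t) z) z :=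
    fun t ht z hz => ((hd t ht).differentiableAt (isOpen_unitDisc.mem_nhds hz)).hasDerivAt
  have hρpos : 0 < 1 - ρ ^ 2 := by
    have : 0 ≤ ρ := by positivity
    nlinarith
  have hmeas' : AEStronglyMeasurable (fun t => deriv (G t) w)
      (volume.restrict (uIoc (0 : ℝ) 1)) := by
    have hz : ∀ n : ℕ, w + ((η / ((n : ℝ) + 2) : ℝ) : ℂ) ∈ unitDisc := by
      intro n
      refine hballD ?_
      have h2 : (0 : ℝ) < (n : ℝ) + 2 := by positivity
      rw [mem_ball_iff_norm, add_sub_cancel_left, Complex.norm_real,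
        Real.norm_of_nonneg (by positivity), div_lt_iff₀ h2]
      nlinarith [(Nat.cast_nonneg n : (0 : ℝ) ≤ n)]
    have hlim : Tendsto (fun n : ℕ => ((η / ((n : ℝ) + 2) : ℝ) : ℂ)) atTop
        (nhdsWithin 0 {0}ᶜ) := by
      refine tendsto_nhdsWithin_iff.2 ⟨?_, Eventually.of_forall fun n => ?_⟩
      · have h3 : Tendsto (fun n : ℕ => η / ((n : ℝ) + 2)) atTop (nhds 0) :=
          tendsto_const_nhds.div_atTop
            (tendsto_atTop_add_const_right _ _ tendsto_natCast_atTop_atTop)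
        exact (Complex.continuous_ofReal.tendsto' 0 0 Complex.ofReal_zero).comp h3
      · rw [mem_compl_singleton_iff, Complex.ofReal_ne_zero]
        positivity
    refine aestronglyMeasurable_of_tendsto_ae atTop
      (f := fun (n : ℕ) t => ((η / ((n : ℝ) + 2) : ℝ) : ℂ)⁻¹ •
        (G t (w + ((η / ((n : ℝ) + 2) : ℝ) : ℂ)) - G t w))
      (fun n => AEStronglyMeasurable.const_smul ((hmeas _ (hz n)).sub (hmeas w hw))
        ((η / ((n : ℝ) + 2) : ℝ) : ℂ)⁻¹) ?_
    refine (ae_restrict_iff' measurableSet_uIoc).2 (ae_of_all _ fun t ht => ?_)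
    exact (hderiv t (hI ht) w hw).tendsto_slope_zero.comp hlim
  have key := intervalIntegral.hasDerivAt_integral_of_dominated_loc_of_deriv_le
    (μ := volume) (a := 0) (b := 1) (F := fun z t => G t z) (F' := fun z t => deriv (G t) z)
    (x₀ := w) (bound := fun _ => 2 * Real.exp 1 ^ 2 * δ / (1 - ρ ^ 2))
    (Metric.ball_mem_nhds w hη0)
    (by filter_upwards [isOpen_unitDisc.mem_nhds hw] with z hz using hmeas z hz)
    (((hc w hw).mono hIcc).intervalIntegrable) hmeas'
    (ae_of_all _ fun t ht z hz => by
      have hb := blochSemi_le_of_im_le (hd t (hI ht)) hδ (him t (hI ht)) (hballD hz)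
      rw [le_div_iff₀ hρpos]
      refine le_trans ?_ hb
      rw [blochSemi]
      have := hball z hz
      gcongr)
    intervalIntegrable_const
    (ae_of_all _ fun t ht z hz => hderiv t (hI ht) z (hballD hz))
  exact key.2.differentiableAt.differentiableWithinAt

lemma abs_im_integral_le {u : ℝ → ℂ} {a b C : ℝ} (hab : a ≤ b)
    (hu : IntervalIntegrable u volume a b) (h : ∀ t ∈ Ioc a b, |(u t).im| ≤ C) :
    |(∫ t in a..b, u t).im| ≤ C * (b - a) := by
  have e : (∫ t in a..b, u t).im = ∫ t in a..b, (u t).im :=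
    (Complex.imCLM.intervalIntegral_comp_comm hu).symm
  rw [e, ← Real.norm_eq_abs, ← abs_of_nonneg (sub_nonneg.2 hab)]
  refine intervalIntegral.norm_integral_le_of_norm_le_const fun t ht => ?_
  rw [uIoc_of_le hab] at ht
  exact h t ht

/-- The function `log (1 / (1 - conj p * z))`, which for `|p| = 1` is a conformal map of the disc
onto a domain contained in a horizontal strip. -/
def logKernel (p z : ℂ) : ℂ := -Complex.log (1 - (starRingEnd ℂ) p * z)

lemma re_one_sub_conj_mul_pos {p z : ℂ} (hp : ‖p‖ = 1) (hz : z ∈ unitDisc) :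
    0 < (1 - (starRingEnd ℂ) p * z).re := by
  have h1 : ‖(starRingEnd ℂ) p * z‖ < 1 := by
    rw [norm_mul, RCLike.norm_conj, hp, one_mul]
    exact mem_unitDisc.1 hz
  rw [Complex.sub_re, Complex.one_re]
  linarith [Complex.re_le_norm ((starRingEnd ℂ) p * z)]

lemma differentiableOn_logKernel {p : ℂ} (hp : ‖p‖ = 1) :
    DifferentiableOn ℂ (logKernel p) unitDisc :=
  (DifferentiableOn.clog (by fun_prop) fun _ hz =>
    Or.inl (re_one_sub_conj_mul_pos hp hz)).neg

lemma abs_im_logKernel_le {p z : ℂ} (hp : ‖p‖ = 1) (hz : z ∈ unitDisc) :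
    |(logKernel p z).im| ≤ Real.pi / 2 := by
  rw [logKernel, Complex.neg_im, abs_neg, Complex.log_im]
  exact Complex.abs_arg_le_pi_div_two_iff.2 (re_one_sub_conj_mul_pos hp hz).le

/-- The mean of `logKernel p` along the orbits of a semigroup. -/
def orbitAverage (φ : ℝ → ℂ → ℂ) (p z : ℂ) : ℂ := ∫ t in (0 : ℝ)..1, logKernel p (φ t z)

namespace IsHoloSemigroup

variable {φ : ℝ → ℂ → ℂ} {p : ℂ}

lemma continuousOn_logKernel (hφ : IsHoloSemigroup φ) (hp : ‖p‖ = 1) {z : ℂ}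
    (hz : z ∈ unitDisc) : ContinuousOn (fun t => logKernel p (φ t z)) (Ici 0) :=
  (differentiableOn_logKernel hp).continuousOn.comp (hφ.continuousOn_orbit hz)
    fun t ht => (hφ.1 t ht).2 hz

lemma intervalIntegrable_logKernel (hφ : IsHoloSemigroup φ) (hp : ‖p‖ = 1) {z : ℂ}
    (hz : z ∈ unitDisc) {a b : ℝ} (ha : 0 ≤ a) (hb : 0 ≤ b) :
    IntervalIntegrable (fun t => logKernel p (φ t z)) volume a b :=
  ((hφ.continuousOn_logKernel hp hz).mono
    fun _ ht => le_trans (le_min ha hb) ht.1).intervalIntegrable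

lemma abs_im_integral_logKernel_le (hφ : IsHoloSemigroup φ) (hp : ‖p‖ = 1) {z : ℂ}
    (hz : z ∈ unitDisc) {a b : ℝ} (ha : 0 ≤ a) (hab : a ≤ b) :
    |(∫ t in a..b, logKernel p (φ t z)).im| ≤ Real.pi / 2 * (b - a) :=
  abs_im_integral_le hab (hφ.intervalIntegrable_logKernel hp hz ha (ha.trans hab))
    fun t ht => abs_im_logKernel_le hp ((hφ.1 t (ha.trans ht.1.le)).2 hz)

lemma differentiableOn_orbitAverage (hφ : IsHoloSemigroup φ) (hp : ‖p‖ = 1) :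
    DifferentiableOn ℂ (orbitAverage φ p) unitDisc :=
  differentiableOn_integral_of_im_le (G := fun t z => logKernel p (φ t z)) (δ := Real.pi / 2)
    (by positivity)
    (fun t ht => (differentiableOn_logKernel hp).comp (hφ.1 t ht).1 (hφ.1 t ht).2)
    (fun _ hz => hφ.continuousOn_logKernel hp hz)
    (fun t ht _ hz => abs_im_logKernel_le hp ((hφ.1 t ht).2 hz))

lemma abs_im_orbitAverage_le (hφ : IsHoloSemigroup φ) (hp : ‖p‖ = 1) {z : ℂ}
    (hz : z ∈ unitDisc) : |(orbitAverage φ p z).im| ≤ Real.pi / 2 := by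
  simpa [orbitAverage] using hφ.abs_im_integral_logKernel_le hp hz le_rfl zero_le_one

lemma abs_im_orbitAverage_sub_le (hφ : IsHoloSemigroup φ) (hp : ‖p‖ = 1) {z : ℂ}
    (hz : z ∈ unitDisc) {s : ℝ} (hs : 0 ≤ s) :
    |(orbitAverage φ p (φ s z) - orbitAverage φ p z).im| ≤ Real.pi * s := by
  have h1 : (0 : ℝ) ≤ 1 + s := by linarith
  have e1 : orbitAverage φ p (φ s z) = ∫ t in s..(1 + s), logKernel p (φ t z) := by
    have h := intervalIntegral.integral_comp_add_right (a := 0) (b := 1)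
      (fun t => logKernel p (φ t z)) s
    rw [zero_add] at h
    rw [← h, orbitAverage]
    refine intervalIntegral.integral_congr fun t ht => ?_
    rw [uIcc_of_le zero_le_one] at ht
    simp only [hφ.2.2.1 t ht.1 s hs z hz]
  have hi : ∀ a b : ℝ, 0 ≤ a → 0 ≤ b →
      IntervalIntegrable (fun t => logKernel p (φ t z)) volume a b := fun a b ha hb =>
    hφ.intervalIntegrable_logKernel hp hz ha hb
  have e2 : orbitAverage φ p (φ s z) - orbitAverage φ p z =
      (∫ t in (1 : ℝ)..(1 + s), logKernel p (φ t z)) - ∫ t in (0 : ℝ)..s, logKernel p (φ t z) := by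
    rw [e1, orbitAverage]
    have h2 := intervalIntegral.integral_add_adjacent_intervals (hi 0 s le_rfl hs)
      (hi s (1 + s) hs h1)
    have h3 := intervalIntegral.integral_add_adjacent_intervals (hi 0 1 le_rfl zero_le_one)
      (hi 1 (1 + s) zero_le_one h1)
    linear_combination h2 - h3
  have h4 := hφ.abs_im_integral_logKernel_le hp hz zero_le_one
    (le_add_of_nonneg_right hs : (1 : ℝ) ≤ 1 + s)
  have h5 := hφ.abs_im_integral_logKernel_le hp hz le_rfl hs
  rw [e2, Complex.sub_im]
  refine (abs_sub _ _).trans ?_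
  linarith

end IsHoloSemigroup

lemma norm_ofReal_mul_of_norm_eq_one {p : ℂ} (hp : ‖p‖ = 1) {r : ℝ} (hr : 0 ≤ r) :
    ‖(r : ℂ) * p‖ = r := by
  rw [norm_mul, hp, mul_one, Complex.norm_real, Real.norm_of_nonneg hr]

/-- A point of the horodisc at `p` through `r * p` is close to `p`. -/
lemma norm_one_sub_conj_mul_le {p w : ℂ} (hp : ‖p‖ = 1) (hw : w ∈ unitDisc) {r : ℝ} (hr0 : 0 ≤ r)
    (hr1 : r < 1) (h : horo p (r * p) ≤ horo p w) : ‖1 - (starRingEnd ℂ) p * w‖ ≤ 2 * (1 - r) := by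
  have hpp : (starRingEnd ℂ) p * (r * p) = r := by
    rw [mul_left_comm, mul_comm _ p, Complex.mul_conj, Complex.normSq_eq_norm_sq, hp]
    simp
  have hd : ‖1 - (r : ℂ)‖ = 1 - r := by
    rw [← Complex.ofReal_one, ← Complex.ofReal_sub, Complex.norm_real,
      Real.norm_of_nonneg (by linarith)]
  set d := ‖1 - (starRingEnd ℂ) p * w‖ with hdef
  have hdpos : 0 < d := norm_pos_iff.2 (one_sub_conj_mul_ne_zero' hp.le hw)
  have hw1 := mem_unitDisc.1 hw
  have hdw : 1 - ‖w‖ ≤ d := by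
    have h1 := norm_sub_norm_le 1 ((starRingEnd ℂ) p * w)
    rwa [norm_one, norm_mul, RCLike.norm_conj, hp, one_mul] at h1
  have hr : 0 < 1 - r := sub_pos.2 hr1
  rw [horo, horo, szegoKernel, szegoKernel, norm_inv, norm_inv, hpp, hd,
    norm_ofReal_mul_of_norm_eq_one hp hr0, ← hdef, inv_pow, inv_pow, ← div_eq_mul_inv,
    ← div_eq_mul_inv, div_le_div_iff₀ (by positivity) (by positivity)] at h
  have h2 : 1 - ‖w‖ ^ 2 ≤ 2 * d := by nlinarith [norm_nonneg w]
  have h3 : (1 - r) * d * ((1 + r) * d) ≤ (1 - r) * d * (2 * (1 - r)) := by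
    nlinarith [mul_le_mul_of_nonneg_right h2 (sq_nonneg (1 - r))]
  have h4 := le_of_mul_le_mul_left h3 (mul_pos hr hdpos)
  nlinarith

lemma IsHoloSemigroup.le_re_orbitAverage {φ : ℝ → ℂ → ℂ} (hφ : IsHoloSemigroup φ) {p : ℂ}
    (hp : ‖p‖ = 1) (hw : ∀ t : ℝ, 0 ≤ t → ∀ z ∈ unitDisc, horo p z ≤ horo p (φ t z)) {r : ℝ}
    (hr0 : 0 ≤ r) (hr1 : r < 1) :
    -Real.log (2 * (1 - r)) ≤ (orbitAverage φ p (r * p)).re := by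
  have hz : (r : ℂ) * p ∈ unitDisc := by
    rwa [mem_unitDisc, norm_ofReal_mul_of_norm_eq_one hp hr0]
  have hi := hφ.intervalIntegrable_logKernel hp hz le_rfl zero_le_one
  have e : (orbitAverage φ p (r * p)).re =
      ∫ t in (0 : ℝ)..1, (logKernel p (φ t (r * p))).re :=
    (Complex.reCLM.intervalIntegral_comp_comm hi).symm
  have hre : IntervalIntegrable (fun t => (logKernel p (φ t (r * p))).re) volume 0 1 := by
    simp only [intervalIntegrable_iff] at hi ⊢
    exact hi.re
  have hmono := intervalIntegral.integral_mono_on zero_le_one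
    (intervalIntegrable_const (c := -Real.log (2 * (1 - r)))) hre fun t ht => by
      have hmem := (hφ.1 t ht.1).2 hz
      rw [logKernel, Complex.neg_re, Complex.log_re]
      exact neg_le_neg (Real.log_le_log
        (norm_pos_iff.2 (one_sub_conj_mul_ne_zero' hp.le hmem))
        (norm_one_sub_conj_mul_le hp hmem hr0 hr1 (hw t ht.1 _ hz)))
  rw [e]
  simpa using hmono

/-- A function with small Bloch seminorm near the circle cannot grow along a radius as fast as
`log (1 / (1 - r))`. -/
lemma not_forall_neg_log_le_re {f : ℂ → ℂ} (hf : DifferentiableOn ℂ f unitDisc) {p : ℂ}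
    (hp : ‖p‖ = 1) {ρ : ℝ} (hρ : ρ < 1)
    (hb : ∀ z ∈ unitDisc, ρ < ‖z‖ → blochSemi f z < 1 / 2) :
    ¬ ∀ r : ℝ, 0 ≤ r → r < 1 → -Real.log (2 * (1 - r)) ≤ (f (r * p)).re := by
  intro hlow
  set c := (max ρ 0 + 1) / 2 with hc
  have hm1 : max ρ 0 < 1 := max_lt hρ zero_lt_one
  have hc1 : c < 1 := by rw [hc]; linarith
  have hcm : max ρ 0 < c := by rw [hc]; linarith
  have hc0 : 0 < c := (le_max_right ρ 0).trans_lt hcm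
  have hcρ : ρ < c := (le_max_left ρ 0).trans_lt hcm
  have hmem : ∀ x ∈ Ico c 1, (x : ℂ) * p ∈ unitDisc := fun x hx => by
    rw [mem_unitDisc, norm_ofReal_mul_of_norm_eq_one hp (hc0.le.trans hx.1)]
    exact hx.2
  have hderiv : ∀ x ∈ Ico c 1, HasDerivAt (fun x : ℝ => (f (x * p)).re + Real.log (1 - x) / 2)
      ((deriv f (x * p) * p).re + -1 / (1 - x) / 2) x := by
    intro x hx
    have h1 : HasDerivAt (fun z : ℂ => f (z * p)) (deriv f (x * p) * p) (x : ℂ) := by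
      have h2 := ((hf.differentiableAt (isOpen_unitDisc.mem_nhds (hmem x hx))).hasDerivAt).comp
        (x : ℂ) ((hasDerivAt_id (x : ℂ)).mul_const p)
      simpa [Function.comp_def] using h2
    have h3 : HasDerivAt (fun y : ℝ => Real.log (1 - y)) (-1 / (1 - x)) x :=
      ((hasDerivAt_id x).const_sub 1).log (sub_pos.2 hx.2).ne'
    exact h1.real_of_complex.add (h3.div_const 2)
  have hanti : AntitoneOn (fun x : ℝ => (f (x * p)).re + Real.log (1 - x) / 2) (Ico c 1) := by
    refine antitoneOn_of_deriv_nonpos (convex_Ico c 1)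
      (fun x hx => (hderiv x hx).continuousAt.continuousWithinAt)
      (fun x hx => (hderiv x (interior_subset hx)).differentiableAt.differentiableWithinAt)
      fun x hx => ?_
    have hx' := interior_subset hx
    have hx0 : 0 ≤ x := hc0.le.trans hx'.1
    have hx1 : 0 < 1 - x := sub_pos.2 hx'.2
    have hn := norm_ofReal_mul_of_norm_eq_one hp hx0
    have hbx := hb _ (hmem x hx') (by rw [hn]; exact hcρ.trans_le hx'.1)
    rw [blochSemi, hn] at hbx
    have h4 : (deriv f (x * p) * p).re ≤ ‖deriv f (x * p)‖ := by
      simpa [hp] using Complex.re_le_norm (deriv f (x * p) * p)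
    have h5 : ‖deriv f (x * p)‖ ≤ 1 / (1 - x) / 2 := by
      rw [div_div, le_div_iff₀ (by positivity)]
      nlinarith [mul_nonneg (mul_nonneg (norm_nonneg (deriv f (x * p))) hx1.le) hx0]
    rw [(hderiv x hx').deriv, neg_div, neg_div]
    linarith
  set K := (f (c * p)).re + Real.log (1 - c) / 2 with hK
  have hc' : 0 < 1 - c := sub_pos.2 hc1
  set y := 2 * (|K| + Real.log 2) + |Real.log (1 - c)| + 1 with hy
  have hlog2 : 0 ≤ Real.log 2 := Real.log_nonneg one_le_two
  have hy0 : 0 ≤ y := by positivity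
  have hexp : Real.exp (-y) ≤ 1 := Real.exp_le_one_iff.2 (by linarith)
  have hexp0 := Real.exp_pos (-y)
  set x := 1 - (1 - c) * Real.exp (-y) with hx
  have hxc : c ≤ x := by nlinarith
  have hx1 : x < 1 := by nlinarith
  have h1x : Real.log (1 - x) = Real.log (1 - c) - y := by
    rw [hx, sub_sub_cancel, Real.log_mul hc'.ne' hexp0.ne', Real.log_exp]
    ring
  have h6 := hanti ⟨le_rfl, hc1⟩ ⟨hxc, hx1⟩ hxc
  have h7 := hlow x (hc0.le.trans hxc) hx1
  rw [Real.log_mul two_ne_zero (sub_pos.2 hx1).ne'] at h7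
  simp only [← hK] at h6
  have h8 := le_abs_self K
  have h9 := le_abs_self (Real.log (1 - c))
  linarith

lemma tendsto_bmoaNorm_and_blochNorm {F : ℝ → ℂ → ℂ} {C : ℝ} (hC : 0 < C)
    (hF : ∀ t, 0 ≤ t → DifferentiableOn ℂ (F t) unitDisc)
    (him : ∀ t, 0 ≤ t → ∀ z ∈ unitDisc, |(F t z).im| ≤ C * t)
    (h0 : Tendsto (fun t => F t 0) (nhdsWithin 0 (Ioi 0)) (nhds 0)) :
    Tendsto (fun t => bmoaNorm (F t)) (nhdsWithin 0 (Ioi 0)) (nhds 0) ∧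
      Tendsto (fun t => blochNorm (F t)) (nhdsWithin 0 (Ioi 0)) (nhds 0) := by
  have hlim : Tendsto (fun t => ‖F t 0‖ + 2 * Real.exp 1 ^ 2 * (C * t)) (nhdsWithin 0 (Ioi 0))
      (nhds 0) := by
    have h1 : Tendsto (fun t : ℝ => 2 * Real.exp 1 ^ 2 * (C * t)) (nhdsWithin 0 (Ioi 0))
        (nhds 0) := by
      have h2 : Continuous fun t : ℝ => 2 * Real.exp 1 ^ 2 * (C * t) := by fun_prop
      simpa using (h2.tendsto 0).mono_left nhdsWithin_le_nhds
    simpa using h0.norm.add h1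
  constructor
  · refine tendsto_of_tendsto_of_tendsto_of_le_of_le' tendsto_const_nhds hlim
      (Eventually.of_forall fun t => add_nonneg (norm_nonneg _) (Real.sqrt_nonneg _)) ?_
    filter_upwards [self_mem_nhdsWithin] with t ht
    have hCt : 0 < C * t := mul_pos hC ht
    refine add_le_add le_rfl (Real.sqrt_le_iff.2 ⟨by positivity, ?_⟩)
    exact Real.iSup_le (fun a => bmoaSemi_le_of_im_le (hF t ht.le) hCt (him t ht.le) a.2)
      (by positivity)
  · refine tendsto_of_tendsto_of_tendsto_of_le_of_le' tendsto_const_nhds hlim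
      (Eventually.of_forall fun t => add_nonneg (norm_nonneg _) (Real.iSup_nonneg fun z =>
        mul_nonneg (norm_nonneg _) (one_sub_sq_norm_pos z.2).le)) ?_
    filter_upwards [self_mem_nhdsWithin] with t ht
    have hCt : 0 < C * t := mul_pos hC ht
    exact add_le_add le_rfl (Real.iSup_le
      (fun z => blochSemi_le_of_im_le (hF t ht.le) hCt (him t ht.le) z.2) (by positivity))

namespace IsHoloSemigroup

variable {φ : ℝ → ℂ → ℂ} {p : ℂ}

lemma orbitAverage_mem_maxSubspaces (hφ : IsHoloSemigroup φ) (hp : ‖p‖ = 1) :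
    orbitAverage φ p ∈ maxSubspaceBMOA φ ∧ orbitAverage φ p ∈ maxSubspaceBloch φ := by
  have hpi : 0 < Real.pi / 2 := by positivity
  have hd := hφ.differentiableOn_orbitAverage hp
  have him := fun z (hz : z ∈ unitDisc) => hφ.abs_im_orbitAverage_le hp hz
  have h0 : (0 : ℂ) ∈ unitDisc := by simp [mem_unitDisc]
  have hlim : Tendsto (fun t => orbitAverage φ p (φ t 0) - orbitAverage φ p 0)
      (nhdsWithin 0 (Ioi 0)) (nhds 0) := by
    have h1 := (hφ.continuousWithinAt_zero h0).tendsto.mono_left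
      (nhdsWithin_mono 0 Ioi_subset_Ici_self)
    rw [hφ.2.1 0 h0] at h1
    have h2 := (hd.continuousOn.continuousAt (isOpen_unitDisc.mem_nhds h0)).tendsto.comp h1
    simpa using h2.sub_const (orbitAverage φ p 0)
  have hnorm := tendsto_bmoaNorm_and_blochNorm
    (F := fun t z => orbitAverage φ p (φ t z) - orbitAverage φ p z) Real.pi_pos
    (fun t ht => (hd.comp (hφ.1 t ht).1 (hφ.1 t ht).2).sub hd)
    (fun t ht z hz => hφ.abs_im_orbitAverage_sub_le hp hz ht) hlim
  exact ⟨⟨⟨hd, _, fun a ha => bmoaSemi_le_of_im_le hd hpi him ha⟩, hnorm.1⟩,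
    ⟨⟨hd, _, fun z hz => blochSemi_le_of_im_le hd hpi him hz⟩, hnorm.2⟩⟩

lemma not_isLittleBloch_orbitAverage (hφ : IsHoloSemigroup φ) (hp : ‖p‖ = 1)
    (hw : ∀ t : ℝ, 0 ≤ t → ∀ z ∈ unitDisc, horo p z ≤ horo p (φ t z)) :
    ¬ IsLittleBloch (orbitAverage φ p) := by
  intro h
  obtain ⟨ρ, hρ, hb⟩ := h.2 (1 / 2) (by norm_num)
  exact not_forall_neg_log_le_re h.1.1 hp hρ hb fun r => hφ.le_re_orbitAverage hp hw

lemma not_isVMOA_orbitAverage (hφ : IsHoloSemigroup φ) (hp : ‖p‖ = 1)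
    (hw : ∀ t : ℝ, 0 ≤ t → ∀ z ∈ unitDisc, horo p z ≤ horo p (φ t z)) :
    ¬ IsVMOA (orbitAverage φ p) := by
  intro h
  have hd := h.1.1
  obtain ⟨ρ, hρ, hb⟩ := h.2 (1 / 8) (by norm_num)
  refine not_forall_neg_log_le_re hd hp hρ (fun a ha hρa => ?_)
    fun r => hφ.le_re_orbitAverage hp hw
  have hint := integrableOn_garsia ha (ne_top_of_le_ne_top ENNReal.ofReal_ne_top
    (lintegral_garsia_le_of_im_le hd (by positivity : 0 < Real.pi / 2)
      (fun z hz => hφ.abs_im_orbitAverage_le hp hz) ha))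
  have h1 := sq_blochSemi_le hd ha hint
  have h2 := hb a ha hρa
  nlinarith

end IsHoloSemigroup

/-- For a non-elliptic semigroup, the maximal subspace of strong continuity
in `BMOA` differs from `VMOA`, and in the Bloch space it differs from the little Bloch
space. -/
theorem maxSubspace_ne_of_not_elliptic
    (φ : ℝ → ℂ → ℂ) (hφ : IsHoloSemigroup φ) (hne : ¬ IsElliptic φ) :
    maxSubspaceBMOA φ ≠ {f | IsVMOA f} ∧
      maxSubspaceBloch φ ≠ {f | IsLittleBloch f} := by
  obtain ⟨p, hp, hw⟩ := hφ.exists_boundary_horo_le hne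
  have hmem := hφ.orbitAverage_mem_maxSubspaces hp
  refine ⟨fun h => ?_, fun h => ?_⟩
  · exact hφ.not_isVMOA_orbitAverage hp hw (h.subset hmem.1)
  · exact hφ.not_isLittleBloch_orbitAverage hp hw (h.subset hmem.2)
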